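/- arXiv:1503.07491 — 7 statements merged into one kernel-verified Lean document; each statement's English description precedes it below -/
import Mathlib

section
/- Let F be a finite family of closed convex sets in R^d whose intersection has finite positive volume. Then there exists a subfamily G of F with at most 2d members such that vol(∩G) ≤ C · e^d · d^{2d} · vol(∩F), where C > 0 is a universal constant (independent of d and F). -/
open MeasureTheory
open scoped RealInnerProductSpace

/-- A compact spanning set contains a basis (of maximal determinant) with respect to which all its
elements have coordinates in `[-1, 1]`. -/
theorem IsCompact.exists_basis_abs_repr_le_one {V : Type*} [NormedAddCommGroup V]
    [NormedSpace ℝ V] [FiniteDimensional ℝ V] {X : Set V} (hX : IsCompact X)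
    (hspan : Submodule.span ℝ X = ⊤) :
    ∃ b : Module.Basis (Fin (Module.finrank ℝ V)) ℝ V,
      (∀ i, b i ∈ X) ∧ ∀ x ∈ X, ∀ i, |b.repr x i| ≤ 1 := by
  classical
  let e₀ := Module.Basis.ofSpan hspan.ge
  have : Fintype ↑((linearIndepOn_empty ℝ id).extend (Set.empty_subset X)) :=
    FiniteDimensional.fintypeBasisIndex e₀
  let e := e₀.reindex (Fintype.equivFinOfCardEq (Module.finrank_eq_card_basis e₀).symm)
  have heX : ∀ i, e i ∈ X := fun i => by
    simp only [e, Module.Basis.reindex_apply]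
    exact Module.Basis.ofSpan_subset hspan.ge ⟨_, rfl⟩
  have hcont : Continuous fun v : Fin (Module.finrank ℝ V) → V => |e.det v| := by
    simp only [Module.Basis.det_apply]
    refine (Continuous.matrix_det (continuous_matrix fun i j => ?_)).abs
    exact (e.coord i).continuous_of_finiteDimensional.comp (continuous_apply j)
  obtain ⟨v, hv, hmax⟩ := (isCompact_univ_pi fun _ => hX).exists_isMaxOn
    ⟨e, fun i _ => heX i⟩ hcont.continuousOn
  have hdet : 1 ≤ |e.det v| := by
    have := hmax (show (e : _ → V) ∈ _ from fun i _ => heX i)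
    simpa [e.det_self] using this
  have hunit : IsUnit (e.det v) := by
    rw [isUnit_iff_ne_zero]; intro h; norm_num [h] at hdet
  obtain ⟨hli, hsp⟩ := (Module.Basis.is_basis_iff_det e).2 hunit
  let b := Module.Basis.mk hli hsp.ge
  have hb : ∀ i, b i = v i := fun i => by simp [b]
  refine ⟨b, fun i => hb i ▸ hv i trivial, fun x hx i => ?_⟩
  have key : e.det (Function.update v i x) = b.repr x i * e.det v := by
    have : (e.det.toMultilinearMap.toLinearMap v i) = (e.det v) • b.coord i := by
      refine b.ext fun j => ?_
      simp only [MultilinearMap.toLinearMap_apply, AlternatingMap.coe_multilinearMap,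
        LinearMap.smul_apply, Module.Basis.coord_apply, Module.Basis.repr_self, smul_eq_mul]
      rw [hb]
      by_cases hij : j = i
      · subst hij; simp
      · rw [Finsupp.single_eq_of_ne (Ne.symm hij), mul_zero]
        exact e.det.map_update_self _ (Ne.symm hij)
    have := LinearMap.congr_fun this x
    simpa [mul_comm] using this
  have h := hmax (show Function.update v i x ∈ _ from fun j _ => by
    by_cases hij : j = i
    · subst hij; simpa using hx
    · simpa [hij] using hv j trivial)
  simp only [Set.mem_ofPred_eq, key, abs_mul] at h
  exact le_of_mul_le_mul_right (by simpa using h) (by linarith)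

/-- In a finite-dimensional space the convex hull of a compact set is compact. -/
theorem IsCompact.convexHull_of_finiteDimensional {V : Type*} [NormedAddCommGroup V]
    [NormedSpace ℝ V] [FiniteDimensional ℝ V] {X : Set V} (hX : IsCompact X) :
    IsCompact (convexHull ℝ X) := by
  classical
  rcases X.eq_empty_or_nonempty with rfl | ⟨x₀, hx₀⟩
  · simp
  let n := Module.finrank ℝ V + 1
  have himg : convexHull ℝ X = (fun p : (Fin n → ℝ) × (Fin n → V) => ∑ i, p.1 i • p.2 i) ''
      (stdSimplex ℝ (Fin n) ×ˢ Set.univ.pi fun _ => X) := by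
    refine Set.Subset.antisymm (fun x hx => ?_) ?_
    · obtain ⟨ι, _, z, w, hz, hind, hw, hsum, rfl⟩ := eq_pos_convex_span_of_mem_convexHull hx
      have hcard : Fintype.card ι ≤ Fintype.card (Fin n) := by
        rw [Fintype.card_fin]
        exact hind.card_le_finrank_succ.trans (Nat.succ_le_succ (Submodule.finrank_le _))
      obtain ⟨f⟩ := Function.Embedding.nonempty_of_card_le hcard
      refine ⟨(Function.extend f w 0, Function.extend f z fun _ => x₀),
        ⟨⟨fun i => ?_, ?_⟩, fun i _ => ?_⟩, ?_⟩
      · by_cases h : ∃ a, f a = i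
        · obtain ⟨a, rfl⟩ := h
          simpa [f.injective.extend_apply] using (hw a).le
        · simp [Function.extend_apply' _ _ _ h]
      · rw [← hsum]
        refine (Fintype.sum_of_injective f f.injective _ _ (fun i hi => ?_) fun a => ?_).symm
        · simp [Function.extend_apply' _ _ _ hi]
        · simp [f.injective.extend_apply]
      · by_cases h : ∃ a, f a = i
        · obtain ⟨a, rfl⟩ := h
          simpa [f.injective.extend_apply] using hz ⟨a, rfl⟩
        · simpa [Function.extend_apply' _ _ _ h] using hx₀
      · refine (Fintype.sum_of_injective f f.injective _ _ (fun i hi => ?_) fun a => ?_).symm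
        · simp [Function.extend_apply' _ _ _ hi]
        · simp [f.injective.extend_apply]
    · rintro _ ⟨⟨c, v⟩, ⟨hc, hv⟩, rfl⟩
      exact (convex_convexHull ℝ X).sum_mem (fun i _ => hc.1 i) hc.2
        fun i _ => subset_convexHull ℝ X (hv i trivial)
  rw [himg]
  exact ((isCompact_stdSimplex ℝ _).prod (isCompact_univ_pi fun _ => hX)).image (by fun_prop)

/-- Pushing a nonzero point of the convex hull of a compact set out to the boundary along its ray,
Carathéodory's theorem needs only `finrank ℝ V` points. -/
theorem exists_smul_mem_convexHull_card_le_finrank {V : Type*} [NormedAddCommGroup V]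
    [NormedSpace ℝ V] [FiniteDimensional ℝ V] {X : Set V} (hX : IsCompact X) {z : V}
    (hz : z ≠ 0) (hzX : z ∈ convexHull ℝ X) :
    ∃ t : ℝ, 1 ≤ t ∧ ∃ s : Finset V, (s : Set V) ⊆ X ∧ s.card ≤ Module.finrank ℝ V ∧
      t • z ∈ convexHull ℝ (s : Set V) := by
  classical
  have hQ := hX.convexHull_of_finiteDimensional
  have hT : IsCompact ((fun t : ℝ => t • z) ⁻¹' convexHull ℝ X) :=
    (isClosedEmbedding_smul_left hz).isCompact_preimage hQ
  obtain ⟨t, ht, hmax⟩ := hT.exists_isMaxOn (f := id) ⟨1, by simpa using hzX⟩ continuousOn_id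
  have ht1 : 1 ≤ t := hmax (show (1 : ℝ) ∈ _ by simpa using hzX)
  obtain ⟨ι, _, p, w, hp, hind, hw, hsum, hx⟩ := eq_pos_convex_span_of_mem_convexHull ht
  replace hx : ∑ i, w i • p i = t • z := hx
  refine ⟨t, ht1, Finset.univ.image p, by simpa using hp, ?_, ?_⟩
  · refine Finset.card_image_le.trans ?_
    by_contra! hlt
    rw [Finset.card_univ] at hlt
    have hcard : Fintype.card ι = Module.finrank ℝ V + 1 :=
      le_antisymm (hind.card_le_finrank_succ.trans (Nat.succ_le_succ (Submodule.finrank_le _))) hlt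
    let b : AffineBasis ι ℝ V :=
      ⟨p, hind, hind.affineSpan_eq_top_iff_card_eq_finrank_add_one.2 hcard⟩
    have hint : t • z ∈ interior (convexHull ℝ (Set.range b)) := by
      rw [b.interior_convexHull]
      intro i
      have : t • z = Finset.univ.affineCombination ℝ b w := by
        rw [Finset.affineCombination_eq_linear_combination _ _ _ hsum, ← hx]; rfl
      rw [this, b.coord_apply_combination_of_mem (Finset.mem_univ i) hsum]
      exact hw i
    have hnhds : (fun s : ℝ => s • z) ⁻¹' convexHull ℝ X ∈ nhds t := by
      refine (continuous_id.smul continuous_const).continuousAt.preimage_mem_nhds ?_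
      exact Filter.mem_of_superset (mem_interior_iff_mem_nhds.1 hint) (convexHull_mono hp)
    obtain ⟨ε, hε, hball⟩ := Metric.mem_nhds_iff.1 hnhds
    have := hmax (hball (show t + ε / 2 ∈ Metric.ball t ε by
      simp [abs_of_pos hε]; linarith))
    simp only [id, Set.mem_ofPred_eq] at this
    linarith
  · rw [← hx]
    exact (convex_convexHull ℝ _).sum_mem (fun i _ => (hw i).le) hsum
      fun i _ => subset_convexHull ℝ _ (by simp)


/-- A convex set with nonempty interior and finite Haar measure is bounded. -/
theorem Convex.isBounded_of_measure_lt_top {V : Type*} [NormedAddCommGroup V]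
    [NormedSpace ℝ V] [FiniteDimensional ℝ V] [MeasurableSpace V] [BorelSpace V]
    (μ : Measure V) [μ.IsAddHaarMeasure] {K : Set V} (hK : Convex ℝ K)
    (hne : (interior K).Nonempty) (hfin : μ K < ⊤) : Bornology.IsBounded K := by
  by_contra hunb
  obtain ⟨p, hp⟩ := hne
  obtain ⟨r, hr, hball⟩ := Metric.mem_nhds_iff.1 (mem_interior_iff_mem_nhds.1 hp)
  obtain ⟨f, hfK, hf⟩ := exists_seq_of_forall_finset_exists (· ∈ K)
    (fun x y => 2 * r ≤ dist x y) (fun s _ => by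
      by_contra! h
      refine hunb (((Bornology.isBounded_biUnion_finset s).2
        fun x _ => Metric.isBounded_ball (x := x) (r := 2 * r)).subset fun y hy => ?_)
      obtain ⟨x, hxs, hx⟩ := h y hy
      exact Set.mem_biUnion hxs (by rwa [Metric.mem_ball, dist_comm]))
  let B : ℕ → Set V := fun n => Metric.ball ((2⁻¹ : ℝ) • (f n + p)) (r / 2)
  have hBK : ∀ n, B n ⊆ K := fun n y hy => by
    have hq : (2 : ℝ) • y - f n ∈ Metric.ball p r := by
      have : (2 : ℝ) • y - f n - p = (2 : ℝ) • (y - (2⁻¹ : ℝ) • (f n + p)) := by module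
      rw [mem_ball_iff_norm, this, norm_smul]
      have := mem_ball_iff_norm.1 hy
      rw [Real.norm_ofNat]
      linarith
    have := hK (hfK n) (hball hq) (by norm_num : (0 : ℝ) ≤ 2⁻¹) (by norm_num : (0 : ℝ) ≤ 2⁻¹)
      (by norm_num)
    convert this using 1
    module
  have hlt : ∀ m n, m < n → Disjoint (B m) (B n) := fun m n hmn => by
    refine Metric.ball_disjoint_ball ?_
    have h1 : (2⁻¹ : ℝ) • (f m + p) - (2⁻¹ : ℝ) • (f n + p) = (2⁻¹ : ℝ) • (f m - f n) := by module
    have h2 := hf m n hmn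
    rw [dist_eq_norm] at h2 ⊢
    rw [h1, norm_smul]
    norm_num
    linarith
  have hdisj : Pairwise (Function.onFun Disjoint B) := fun m n hmn =>
    (lt_or_gt_of_ne hmn).elim (hlt m n) fun h => (hlt n m h).symm
  have hpos : μ (Metric.ball (0 : V) (r / 2)) ≠ 0 :=
    (Metric.measure_ball_pos μ _ (by positivity)).ne'
  have : μ (⋃ n, B n) = ⊤ := by
    rw [measure_iUnion hdisj fun n => Metric.isOpen_ball.measurableSet]
    simp only [B, Measure.addHaar_ball_center]
    exact ENNReal.tsum_const_eq_top_of_ne_zero hpos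
  exact hfin.not_ge (this ▸ measure_mono (Set.iUnion_subset hBK))

/-- A convex set of positive Haar measure has nonempty interior. -/
theorem Convex.interior_nonempty_of_measure_pos {V : Type*} [NormedAddCommGroup V]
    [NormedSpace ℝ V] [FiniteDimensional ℝ V] [MeasurableSpace V] [BorelSpace V]
    (μ : Measure V) [μ.IsAddHaarMeasure] {K : Set V} (hK : Convex ℝ K)
    (hpos : 0 < μ K) : (interior K).Nonempty := by
  by_contra! h
  refine hpos.ne' (measure_mono_null ?_ (hK.addHaar_frontier μ))
  rw [frontier, h, Set.sdiff_empty]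
  exact subset_closure

/-- A convex body `K` in dimension `d` has an interior point `c` (the centroid of an inscribed
simplex of maximal volume) such that `K - c` contains `-(K - c) / d`. -/
theorem Convex.exists_mem_interior_homothety_neg_inv_finrank {V : Type*} [NormedAddCommGroup V]
    [NormedSpace ℝ V] [FiniteDimensional ℝ V] [Nontrivial V] {K : Set V} (hK : Convex ℝ K)
    (hc : IsCompact K) (hne : (interior K).Nonempty) :
    ∃ c ∈ interior K, ∀ x ∈ K, c - (Module.finrank ℝ V : ℝ)⁻¹ • (x - c) ∈ K := by
  obtain ⟨p, hp⟩ := hne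
  have hpK := interior_subset hp
  let X : Set (V × ℝ) := (fun x => (x, (1 : ℝ))) '' K
  have hX : IsCompact X := hc.image (by fun_prop)
  have hspan : Submodule.span ℝ X = ⊤ := by
    have hmem : ∀ x ∈ K, (x, (1 : ℝ)) ∈ Submodule.span ℝ X := fun x hx =>
      Submodule.subset_span ⟨x, hx, rfl⟩
    have h0 : ∀ v : V, (v, (0 : ℝ)) ∈ Submodule.span ℝ X := fun v => by
      have : Filter.Tendsto (fun ε : ℝ => p + ε • v) (nhdsWithin 0 (Set.Ioi 0)) (nhds p) := by
        refine Filter.Tendsto.mono_left ?_ nhdsWithin_le_nhds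
        have : Continuous fun ε : ℝ => p + ε • v := by fun_prop
        simpa using this.tendsto 0
      obtain ⟨ε, hε, hεpos⟩ := ((this.eventually (mem_interior_iff_mem_nhds.1 hp)).and
        self_mem_nhdsWithin).exists
      have hεpos : (0 : ℝ) < ε := hεpos
      have := Submodule.smul_mem _ ε⁻¹ (Submodule.sub_mem _ (hmem _ hε) (hmem p hpK))
      simpa [smul_smul, hεpos.ne'] using this
    refine Submodule.eq_top_iff'.2 fun ⟨v, s⟩ => ?_
    have := Submodule.add_mem _ (h0 (v - s • p)) (Submodule.smul_mem _ s (hmem p hpK))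
    simpa using this
  obtain ⟨b, hbX, hb⟩ := hX.exists_basis_abs_repr_le_one hspan
  choose x hxK hx using hbX
  set d := Module.finrank ℝ V with hd
  have hdpos : (0 : ℝ) < d := by exact_mod_cast Module.finrank_pos
  have hcard : (Fintype.card (Fin (Module.finrank ℝ (V × ℝ))) : ℝ) = d + 1 := by
    simp [hd]
  let c : V := ((d : ℝ) + 1)⁻¹ • ∑ i, x i
  have hcK : ∀ y ∈ K, c - (d : ℝ)⁻¹ • (y - c) ∈ K := fun y hy => by
    have hrepr := b.sum_repr (y, (1 : ℝ))
    simp only [← hx] at hrepr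
    have h1 : ∑ i, b.repr (y, 1) i • x i = y := by
      simpa [Prod.fst_sum] using congrArg Prod.fst hrepr
    have h2 : ∑ i, b.repr (y, 1) i = 1 := by
      simpa [Prod.snd_sum] using congrArg Prod.snd hrepr
    have h3 : c - (d : ℝ)⁻¹ • (y - c) = ∑ i, ((d : ℝ)⁻¹ * (1 - b.repr (y, 1) i)) • x i := by
      simp only [mul_smul, sub_smul, one_smul, ← Finset.smul_sum, Finset.sum_sub_distrib, h1]
      simp only [c]
      match_scalars
      · field_simp
        ring
      · ring
    rw [h3]
    refine hK.sum_mem (fun i _ => ?_) ?_ fun i _ => hxK i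
    · have := (abs_le.1 (hb _ ⟨y, hy, rfl⟩ i)).2
      exact mul_nonneg (by positivity) (by linarith)
    · rw [← Finset.mul_sum, Finset.sum_sub_distrib, h2, Finset.sum_const, Finset.card_univ,
        nsmul_eq_mul, hcard]
      field_simp
      ring
  refine ⟨c, hK.openSegment_interior_self_subset_interior hp (hcK p hpK) ?_, hcK⟩
  refine ⟨((d : ℝ) + 1)⁻¹, d / ((d : ℝ) + 1), by positivity, by positivity, ?_, ?_⟩
  · field_simp
    ring
  · match_scalars <;> field_simp <;> ring

/-- The bipolar theorem: a closed convex set containing `c` is the intersection of the half-spaces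
`⟪a, x - c⟫ ≤ 1` that contain it. -/
theorem mem_of_forall_inner_sub_le_one {V : Type*} [NormedAddCommGroup V]
    [InnerProductSpace ℝ V] [CompleteSpace V] {A : Set V} (hA : IsClosed A) (hconv : Convex ℝ A)
    {c x : V} (hc : c ∈ A)
    (h : ∀ a : V, (∀ y ∈ A, ⟪a, y - c⟫ ≤ 1) → ⟪a, x - c⟫ ≤ 1) : x ∈ A := by
  by_contra hx
  obtain ⟨f, u, hfA, hfx⟩ := geometric_hahn_banach_closed_point hconv hA hx
  have hδ : 0 < u - f c := sub_pos.2 (hfA c hc)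
  have hinner : ∀ y, ⟪(u - f c)⁻¹ • (InnerProductSpace.toDual ℝ V).symm f, y - c⟫ =
      (f y - f c) / (u - f c) := fun y => by
    rw [real_inner_smul_left, InnerProductSpace.toDual_symm_apply, map_sub]
    ring
  have := h ((u - f c)⁻¹ • (InnerProductSpace.toDual ℝ V).symm f) fun y hy => by
    rw [hinner, div_le_one hδ]
    linarith [hfA y hy]
  rw [hinner, div_le_one hδ] at this
  linarith

/-- A finite family of closed convex sets in dimension `d` whose intersection `K` is a convex body
has a subfamily of at most `2d` members whose intersection lies in a homothet of `K` with ratio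
`-d (d + 2)`. -/
theorem exists_subfamily_sInter_homothety_subset {V : Type*} [NormedAddCommGroup V]
    [InnerProductSpace ℝ V] [FiniteDimensional ℝ V] [Nontrivial V] (F : Finset (Set V))
    (hF : ∀ A ∈ F, IsClosed A ∧ Convex ℝ A) (hbdd : Bornology.IsBounded (⋂₀ (F : Set (Set V))))
    (hne : (interior (⋂₀ (F : Set (Set V)))).Nonempty) :
    ∃ G ⊆ F, G.card ≤ 2 * Module.finrank ℝ V ∧ ∃ c : V, ∀ x ∈ ⋂₀ (G : Set (Set V)),
      c - ((Module.finrank ℝ V : ℝ) * (Module.finrank ℝ V + 2))⁻¹ • (x - c) ∈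
        ⋂₀ (F : Set (Set V)) := by
  classical
  have hclosed : IsClosed (⋂₀ (F : Set (Set V))) := isClosed_sInter fun A hA => (hF A hA).1
  have hcomp := Metric.isCompact_of_isClosed_isBounded hclosed hbdd
  have hconv : Convex ℝ (⋂₀ (F : Set (Set V))) := convex_sInter fun A hA => (hF A hA).2
  obtain ⟨c, hcint, hc⟩ := hconv.exists_mem_interior_homothety_neg_inv_finrank hcomp hne
  have hcA : ∀ A ∈ F, c ∈ A := fun A hA => interior_subset hcint A hA
  set d := Module.finrank ℝ V with hd
  have hdpos : (0 : ℝ) < d := by exact_mod_cast Module.finrank_pos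
  obtain ⟨A₀, hA₀⟩ : F.Nonempty := by
    by_contra h
    rw [Finset.not_nonempty_iff_eq_empty] at h
    subst h
    simp only [Finset.coe_empty, Set.sInter_empty] at hbdd
    exact NormedSpace.unbounded_univ ℝ V hbdd
  let X : Set V := ⋃ A ∈ F, {a | ∀ y ∈ A, ⟪a, y - c⟫ ≤ 1}
  have hXmem : ∀ a, a ∈ X ↔ ∃ A ∈ F, ∀ y ∈ A, ⟪a, y - c⟫ ≤ 1 := fun a => by simp [X]
  have hbipolar : ∀ x, (∀ a ∈ X, ⟪a, x - c⟫ ≤ 1) → x ∈ ⋂₀ (F : Set (Set V)) :=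
    fun x hx A hA => mem_of_forall_inner_sub_le_one (hF A hA).1 (hF A hA).2 (hcA A hA)
      fun a ha => hx a ((hXmem a).2 ⟨A, hA, ha⟩)
  have hle : ∀ a ∈ X, ∀ x ∈ ⋂₀ (F : Set (Set V)), ⟪a, x - c⟫ ≤ 1 := fun a ha x hx => by
    obtain ⟨A, hA, h⟩ := (hXmem a).1 ha
    exact h x (hx A hA)
  have hXcomp : IsCompact X := by
    refine Metric.isCompact_of_isClosed_isBounded ?_ ?_
    · refine F.finite_toSet.isClosed_biUnion fun A _ => ?_
      have : {a : V | ∀ y ∈ A, ⟪a, y - c⟫ ≤ 1} = ⋂ y ∈ A, {a | ⟪a, y - c⟫ ≤ 1} := by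
        ext; simp
      rw [this]
      exact isClosed_biInter fun y _ => isClosed_le (by fun_prop) continuous_const
    · obtain ⟨r, hr, hball⟩ := Metric.nhds_basis_closedBall.mem_iff.1
        (mem_interior_iff_mem_nhds.1 hcint)
      refine isBounded_iff_forall_norm_le.2 ⟨r⁻¹, fun a ha => ?_⟩
      rcases eq_or_ne a 0 with rfl | ha0
      · simpa using hr.le
      have hn : 0 < ‖a‖ := norm_pos_iff.2 ha0
      have := hle a ha (c + (r / ‖a‖) • a) (hball (by
        rw [mem_closedBall_iff_norm, add_sub_cancel_left, norm_smul,
          Real.norm_of_nonneg (by positivity)]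
        field_simp; rfl))
      rw [add_sub_cancel_left, real_inner_smul_right, real_inner_self_eq_norm_sq] at this
      rw [← one_div, le_div_iff₀ hr]
      calc ‖a‖ * r = r / ‖a‖ * ‖a‖ ^ 2 := by field_simp
        _ ≤ 1 := this
  have hspan : Submodule.span ℝ X = ⊤ := by
    rw [← Submodule.orthogonal_eq_bot_iff, Submodule.eq_bot_iff]
    intro u hu
    have hline : ∀ s : ℝ, c + s • u ∈ ⋂₀ (F : Set (Set V)) := fun s => hbipolar _ fun a ha => by
      rw [add_sub_cancel_left, real_inner_smul_right,
        Submodule.inner_right_of_mem_orthogonal (Submodule.subset_span ha) hu]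
      simp
    by_contra hu0
    obtain ⟨R, hR⟩ := isBounded_iff_forall_norm_le.1 hbdd
    have hn : 0 < ‖u‖ := norm_pos_iff.2 hu0
    have h1 := hR _ (hline ((R + ‖c‖ + 1) / ‖u‖))
    have h2 : ‖((R + ‖c‖ + 1) / ‖u‖) • u‖ = |R + ‖c‖ + 1| := by
      rw [norm_smul, norm_div, norm_norm, Real.norm_eq_abs]
      field_simp
    have h3 := norm_sub_le (c + ((R + ‖c‖ + 1) / ‖u‖) • u) c
    rw [add_sub_cancel_left, h2] at h3
    linarith [le_abs_self (R + ‖c‖ + 1)]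
  obtain ⟨b, hbX, hb⟩ := hXcomp.exists_basis_abs_repr_le_one hspan
  let z : V := -(((d : ℝ) * d)⁻¹ • ∑ i, b i)
  have hz0 : z ≠ 0 := by
    intro h
    have hsum : ∑ i, b i = 0 := by
      have : ((d : ℝ) * d)⁻¹ ≠ 0 := by positivity
      exact (smul_eq_zero.1 (neg_eq_zero.1 h)).resolve_left this
    have := Fintype.linearIndependent_iff.1 b.linearIndependent (fun _ => 1) (by simpa using hsum)
      ⟨0, Module.finrank_pos⟩
    simp at this
  have h0X : (0 : V) ∈ X := (hXmem 0).2 ⟨A₀, hA₀, by simp⟩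
  have hzX : z ∈ convexHull ℝ X := by
    refine mem_of_forall_inner_sub_le_one (c := 0)
      hXcomp.convexHull_of_finiteDimensional.isClosed (convex_convexHull ℝ X)
      (subset_convexHull ℝ X h0X) fun u hu => ?_
    have hu' : c + u ∈ ⋂₀ (F : Set (Set V)) := hbipolar _ fun a ha => by
      rw [add_sub_cancel_left, real_inner_comm]
      simpa using hu a (subset_convexHull ℝ X ha)
    have h1 : ∀ i, ⟪b i, -((d : ℝ)⁻¹ • u)⟫ ≤ 1 := fun i => by
      have := hle (b i) (hbX i) _ (hc _ hu')
      simpa [add_sub_cancel_left] using this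
    have h2 : ⟪u, z - 0⟫ = (d : ℝ)⁻¹ * ∑ i, ⟪b i, -((d : ℝ)⁻¹ • u)⟫ := by
      simp only [z, sub_zero, inner_neg_right, real_inner_smul_right, inner_sum,
        Finset.sum_neg_distrib, ← Finset.mul_sum, real_inner_comm u]
      rw [mul_inv]; ring
    rw [h2]
    calc (d : ℝ)⁻¹ * ∑ i, ⟪b i, -((d : ℝ)⁻¹ • u)⟫
        ≤ (d : ℝ)⁻¹ * ∑ _i : Fin d, (1 : ℝ) := by
          gcongr with i; exact h1 i
      _ = 1 := by simp [hdpos.ne']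
  obtain ⟨t, ht, s, hsX, hscard, hts⟩ :=
    exists_smul_mem_convexHull_card_le_finrank hXcomp hz0 hzX
  choose! A hAF hA using fun a (ha : a ∈ X) => (hXmem a).1 ha
  refine ⟨Finset.univ.image (fun i => A (b i)) ∪ s.image A, ?_, ?_, c, fun x hx => ?_⟩
  · refine Finset.union_subset (fun B hB => ?_) fun B hB => ?_
    · obtain ⟨i, _, rfl⟩ := Finset.mem_image.1 hB
      exact hAF _ (hbX i)
    · obtain ⟨a, ha, rfl⟩ := Finset.mem_image.1 hB
      exact hAF _ (hsX ha)
  · refine (Finset.card_union_le _ _).trans ?_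
    have h1 := Finset.card_image_le (s := Finset.univ) (f := fun i => A (b i))
    have h2 := Finset.card_image_le (s := s) (f := A)
    rw [Finset.card_univ, Fintype.card_fin] at h1
    omega
  · have hbx : ∀ i, ⟪b i, x - c⟫ ≤ 1 := fun i =>
      hA _ (hbX i) x (hx _ (by simp))
    have hsx : ∀ a ∈ s, ⟪a, x - c⟫ ≤ 1 := fun a ha =>
      hA _ (hsX ha) x (hx _ (by
        simp only [Finset.coe_union, Set.mem_union]
        exact Or.inr (Finset.mem_coe.2 (Finset.mem_image_of_mem A ha))))
    have htz : ⟪t • z, x - c⟫ ≤ 1 := by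
      have hhalf : Convex ℝ {a : V | ⟪a, x - c⟫ ≤ 1} :=
        convex_halfSpace_le
          ⟨fun _ _ => inner_add_left _ _ _, fun _ _ => real_inner_smul_left _ _ _⟩ 1
      exact convexHull_min hsx hhalf hts
    have hzx : ⟪z, x - c⟫ ≤ 1 := by
      rw [real_inner_smul_left] at htz
      by_contra! h
      nlinarith
    have hsumx : -∑ i, ⟪b i, x - c⟫ ≤ d * d := by
      have : ⟪z, x - c⟫ = ((d : ℝ) * d)⁻¹ * -∑ i, ⟪b i, x - c⟫ := by
        simp only [z, inner_neg_left, real_inner_smul_left, sum_inner]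
        ring
      rw [this, inv_mul_le_iff₀ (by positivity)] at hzx
      linarith
    refine hbipolar _ fun q hq => ?_
    have hexp : ⟪q, x - c⟫ = ∑ i, b.repr q i * ⟪b i, x - c⟫ := by
      conv_lhs => rw [← b.sum_repr q]
      simp only [sum_inner, real_inner_smul_left]
    have hterm : ∀ i, (1 - b.repr q i) * ⟪b i, x - c⟫ ≤ 2 := fun i => by
      have := abs_le.1 (hb q hq i)
      nlinarith [hbx i, mul_le_mul_of_nonneg_left (hbx i) (by linarith : 0 ≤ 1 - b.repr q i)]
    have hsum2 : ∑ i, (1 - b.repr q i) * ⟪b i, x - c⟫ ≤ 2 * d := by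
      refine (Finset.sum_le_sum fun i _ => hterm i).trans ?_
      simp [← hd, mul_comm]
    have hsplit : ∑ i, (1 - b.repr q i) * ⟪b i, x - c⟫ = ∑ i, ⟪b i, x - c⟫ - ⟪q, x - c⟫ := by
      rw [hexp, ← Finset.sum_sub_distrib]
      exact Finset.sum_congr rfl fun i _ => by ring
    have : c - ((d : ℝ) * (d + 2))⁻¹ • (x - c) - c = -(((d : ℝ) * (d + 2))⁻¹ • (x - c)) := by abel
    rw [this, inner_neg_right, real_inner_smul_right, ← mul_neg, inv_mul_le_iff₀ (by positivity)]
    nlinarith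

/-- Quantitative volume Helly theorem (Bárány–Katchalski–Pach, sharpened):
if a finite family of closed convex sets in `ℝ^d` has intersection of finite
positive volume, then some subfamily of at most `2d` members has intersection
of volume at most `C · e^d · d^(2d)` times that of the whole family, where
`C > 0` is a universal constant. -/
theorem quantitative_volume_helly :
    ∃ C : ℝ, 0 < C ∧
      ∀ (d : ℕ) (F : Finset (Set (EuclideanSpace ℝ (Fin d)))),
        (∀ A ∈ F, IsClosed A ∧ Convex ℝ A) →
        0 < volume (⋂₀ (F : Set (Set (EuclideanSpace ℝ (Fin d))))) →
        volume (⋂₀ (F : Set (Set (EuclideanSpace ℝ (Fin d))))) < ⊤ →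
        ∃ G ⊆ F, G.card ≤ 2 * d ∧
          volume (⋂₀ (G : Set (Set (EuclideanSpace ℝ (Fin d))))) ≤
            ENNReal.ofReal (C * Real.exp d * (d : ℝ) ^ (2 * d)) *
              volume (⋂₀ (F : Set (Set (EuclideanSpace ℝ (Fin d))))) := by
  refine ⟨Real.exp 2, Real.exp_pos _, fun d F hF hpos hfin => ?_⟩
  set K := ⋂₀ (F : Set (Set (EuclideanSpace ℝ (Fin d)))) with hKdef
  rcases Nat.eq_zero_or_pos d with rfl | hd
  · refine ⟨∅, by simp, by simp, ?_⟩
    have hK : K = Set.univ :=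
      (Set.nonempty_of_mem (nonempty_of_measure_ne_zero hpos.ne').some_mem).eq_univ
    rw [hK, Finset.coe_empty, Set.sInter_empty]
    refine le_mul_of_one_le_left zero_le ?_
    simp
  have hconv : Convex ℝ K := convex_sInter fun A hA => (hF A hA).2
  have hne := hconv.interior_nonempty_of_measure_pos volume hpos
  have hbdd := hconv.isBounded_of_measure_lt_top volume hne hfin
  have : Nonempty (Fin d) := ⟨⟨0, hd⟩⟩
  obtain ⟨G, hGF, hcard, c, hG⟩ := exists_subfamily_sInter_homothety_subset F hF hbdd hne
  rw [finrank_euclideanSpace_fin] at hcard hG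
  refine ⟨G, hGF, hcard, ?_⟩
  have hdpos : (0 : ℝ) < d := by exact_mod_cast hd
  have hsub : ⋂₀ (G : Set (Set (EuclideanSpace ℝ (Fin d)))) ⊆
      AffineMap.homothety c (-((d : ℝ) * (d + 2))) '' K := fun x hx => by
    refine ⟨_, hG x hx, ?_⟩
    simp only [AffineMap.homothety_apply, vsub_eq_sub, vadd_eq_add]
    match_scalars <;> field_simp
    ring
  refine (measure_mono hsub).trans ?_
  rw [Measure.addHaar_image_homothety, finrank_euclideanSpace_fin]
  gcongr
  rw [abs_pow, abs_neg, abs_of_pos (by positivity)]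
  have h1 : ((d : ℝ) * (d + 2)) ^ d = (1 + 2 / d) ^ d * (d : ℝ) ^ (2 * d) := by
    rw [pow_mul, ← mul_pow]
    congr 1
    field_simp
  have h2 : (1 + 2 / (d : ℝ)) ^ d ≤ Real.exp 2 := by
    calc (1 + 2 / (d : ℝ)) ^ d ≤ Real.exp (2 / d) ^ d := by
          gcongr
          linarith [Real.add_one_le_exp (2 / (d : ℝ))]
      _ = Real.exp 2 := by
          rw [← Real.exp_nat_mul]
          congr 1
          field_simp
  rw [h1]
  gcongr
  exact h2.trans (le_mul_of_one_le_right (Real.exp_pos _).le (Real.one_le_exp hdpos.le))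
end

section
/- Let F be a finite family of closed convex sets in R^d whose intersection has finite positive volume. Then there exists a subfamily G of F with at most 2d members such that vol(∩G) ≤ d^d · (d+1)^{(3d+1)/2} · (d!)^{-1/2} · vol(∩F). -/
open MeasureTheory

section ConvexGeometry

open Module

section Caratheodory

variable {E : Type*} [AddCommGroup E] [Module ℝ E] [FiniteDimensional ℝ E]

/-- A form of Carathéodory's theorem which trades the last point of the combination for the
origin. -/
lemma exists_sum_smul_eq_of_mem_convexHull {T : Set E} {y : E} (hy : y ∈ convexHull ℝ T) :
    ∃ μ : Fin (finrank ℝ E) → ℝ, ∃ v : Fin (finrank ℝ E) → E, (∀ i, v i ∈ T) ∧ (∀ i, 0 ≤ μ i) ∧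
      ∑ i, μ i ≤ 1 ∧ ∑ i, μ i • v i = y := by
  classical
  obtain ⟨t₀, ht₀⟩ := convexHull_nonempty_iff.mp ⟨y, hy⟩
  obtain ⟨ι, _, z, w, hz, hind, hw, hw1, hwy⟩ := eq_pos_convex_span_of_mem_convexHull hy
  have hcard : Fintype.card ι ≤ finrank ℝ E + 1 := hind.card_le_finrank_succ.trans
    (Nat.succ_le_succ (Submodule.finrank_le _))
  obtain ⟨s, hs, μ, hμ, hμ1, hμy⟩ : ∃ s : Finset ι, s.card ≤ finrank ℝ E ∧ ∃ μ : ι → ℝ,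
      (∀ i, 0 ≤ μ i) ∧ ∑ i ∈ s, μ i ≤ 1 ∧ ∑ i ∈ s, μ i • z i = y := by
    rcases Nat.lt_or_ge (finrank ℝ E) (Fintype.card ι) with h | h
    · have hdep : ¬ LinearIndependent ℝ z := fun hli => h.not_ge hli.fintype_card_le_finrank
      obtain ⟨c, hc, hcs, j, hj⟩ : ∃ c : ι → ℝ, ∑ i, c i • z i = 0 ∧ 0 ≤ ∑ i, c i ∧
          ∃ i, c i ≠ 0 := by
        obtain ⟨c, hc, hc0⟩ := Fintype.not_linearIndependent_iff.mp hdep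
        rcases le_total 0 (∑ i, c i) with h0 | h0
        · exact ⟨c, hc, h0, hc0⟩
        · exact ⟨-c, by simp [hc], by simpa using h0, by simpa using hc0⟩
      have hpos : (Finset.univ.filter fun i => 0 < c i).Nonempty := by
        by_contra hne
        have hle : ∀ i ∈ Finset.univ, c i ≤ 0 := fun i hi => by
          by_contra! hlt
          exact hne ⟨i, by simpa using hlt⟩
        have h0 := (Finset.sum_eq_zero_iff_of_nonpos hle).mp
          (le_antisymm (Finset.sum_nonpos hle) hcs)
        exact hj (h0 j (Finset.mem_univ j))
      obtain ⟨k, hk, hmin⟩ := Finset.exists_min_image _ (fun i => w i / c i) hpos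
      have hck : 0 < c k := by simpa using hk
      have hτ : 0 ≤ w k / c k := (div_pos (hw k) hck).le
      have hk0 : w k - w k / c k * c k = 0 := by field_simp; simp
      refine ⟨Finset.univ.erase k, ?_, fun i => w i - w k / c k * c i, fun i => ?_, ?_, ?_⟩
      · rw [Finset.card_erase_of_mem (Finset.mem_univ k), Finset.card_univ]
        omega
      · rcases le_or_gt (c i) 0 with hi | hi
        · nlinarith [hw i]
        · have := hmin i (by simpa using hi)
          rw [le_div_iff₀ hi] at this
          linarith
      · rw [Finset.sum_erase _ (f := fun i => w i - w k / c k * c i) hk0, Finset.sum_sub_distrib, ← Finset.mul_sum, hw1]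
        nlinarith
      · rw [Finset.sum_erase _ (f := fun i => (w i - w k / c k * c i) • z i)
          (by rw [hk0, zero_smul])]
        simp only [sub_smul, mul_smul, Finset.sum_sub_distrib, ← Finset.smul_sum, hc, hwy]
        simp
    · exact ⟨Finset.univ, h, w, fun i => (hw i).le, hw1.le, hwy⟩
  obtain ⟨f⟩ : Nonempty (s ↪ Fin (finrank ℝ E)) :=
    Function.Embedding.nonempty_of_card_le (by simpa using hs)
  have hext : ∀ i ∉ Set.range f, Function.extend f (fun i => μ i) 0 i = 0 := fun i hi => by
    rw [Function.extend_apply' _ _ _ (by simpa using hi)]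
    rfl
  refine ⟨Function.extend f (fun i => μ i) 0, Function.extend f (fun i => z i) fun _ => t₀,
    fun i => ?_, fun i => ?_, ?_, ?_⟩
  · by_cases hi : i ∈ Set.range f
    · obtain ⟨j, rfl⟩ := hi
      rw [f.injective.extend_apply]
      exact hz ⟨_, rfl⟩
    · rwa [Function.extend_apply' _ _ _ (by simpa using hi)]
  · by_cases hi : i ∈ Set.range f
    · obtain ⟨j, rfl⟩ := hi
      rw [f.injective.extend_apply]
      exact hμ j
    · exact (hext i hi).ge
  · rw [← Fintype.sum_of_injective f f.injective (fun i : s => μ i) _ hext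
      fun i => by rw [f.injective.extend_apply]]
    rwa [Finset.sum_coe_sort s μ]
  · rw [← Fintype.sum_of_injective f f.injective (fun i : s => μ i • z i) _
      (fun i hi => by rw [hext i hi, zero_smul])
      fun i => by rw [f.injective.extend_apply, f.injective.extend_apply]]
    rwa [Finset.sum_coe_sort s fun i => μ i • z i]

end Caratheodory

section NormedSpace

variable {E : Type*} [NormedAddCommGroup E] [NormedSpace ℝ E]

lemma exists_sum_smul_eq_of_mem_closure_convexHull [FiniteDimensional ℝ E] {T : Set E}
    (hT : IsCompact T) {y : E} (hy : y ∈ closure (convexHull ℝ T)) :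
    ∃ μ : Fin (finrank ℝ E) → ℝ, ∃ v : Fin (finrank ℝ E) → E, (∀ i, v i ∈ T) ∧ (∀ i, 0 ≤ μ i) ∧
      ∑ i, μ i ≤ 1 ∧ ∑ i, μ i • v i = y := by
  let M : Set (Fin (finrank ℝ E) → ℝ) := Set.Icc 0 1 ∩ {μ | ∑ i, μ i ≤ 1}
  have hM : IsCompact M := isCompact_Icc.inter_right
    (isClosed_le (by fun_prop) continuous_const)
  have hcomp := (hM.prod (isCompact_univ_pi fun _ : Fin (finrank ℝ E) => hT)).image
    (f := fun q => ∑ i, q.1 i • q.2 i) (by fun_prop)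
  have hsub : convexHull ℝ T ⊆
      (fun q : (Fin (finrank ℝ E) → ℝ) × (Fin (finrank ℝ E) → E) => ∑ i, q.1 i • q.2 i) ''
        (M ×ˢ Set.univ.pi fun _ => T) := by
    intro x hx
    obtain ⟨μ, v, hv, hμ, hμ1, rfl⟩ := exists_sum_smul_eq_of_mem_convexHull hx
    refine ⟨(μ, v), ⟨⟨⟨hμ, fun i => ?_⟩, hμ1⟩, fun i _ => hv i⟩, rfl⟩
    exact (Finset.single_le_sum (fun j _ => hμ j) (Finset.mem_univ i)).trans hμ1
  obtain ⟨⟨μ, v⟩, ⟨⟨⟨hμ, -⟩, hμ1⟩, hv⟩, rfl⟩ := closure_minimal hsub hcomp.isClosed hy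
  exact ⟨μ, v, fun i => hv i trivial, hμ, hμ1, rfl⟩

lemma Convex.isBounded_of_measure_ne_top [MeasurableSpace E] [BorelSpace E] {μ : Measure E}
    [μ.IsAddHaarMeasure] {C : Set E} (hC : Convex ℝ C)
    (hint : (interior C).Nonempty) (hfin : μ C ≠ ⊤) : Bornology.IsBounded C := by
  obtain ⟨p, hp⟩ := hint
  obtain ⟨r, hr, hball⟩ := Metric.isOpen_iff.mp isOpen_interior p hp
  replace hball := hball.trans interior_subset
  by_contra hunb
  obtain ⟨N, hN⟩ := ENNReal.exists_nat_mul_gt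
    (Metric.measure_ball_pos μ (0 : E) (half_pos hr)).ne' hfin
  obtain ⟨x, hx, hxR⟩ : ∃ x ∈ C, 2 * N * r + r < ‖x - p‖ := by
    by_contra! h
    exact hunb (Metric.isBounded_closedBall.subset
      fun x hx => mem_closedBall_iff_norm.mpr (h x hx))
  set R := ‖x - p‖ with hR_def
  have hNr : 0 ≤ N * r := by positivity
  have hR : 0 < R := by linarith
  let q : ℕ → E := fun i => p + (i * r / R) • (x - p)
  have hsub : ∀ i ∈ Finset.range N, Metric.ball (q i) (r / 2) ⊆ C := by
    intro i hi y hy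
    have hiN : (i : ℝ) ≤ N := by exact_mod_cast (Finset.mem_range.mp hi).le
    have ht0 : 0 ≤ i * r / R := by positivity
    have ht : i * r / R ≤ 1 / 2 := by
      rw [div_le_iff₀ hR]
      nlinarith
    set t := i * r / R with ht_def
    have ht1 : 0 < 1 - t := by linarith
    have hz : p + (1 - t)⁻¹ • (y - q i) ∈ C := hball (by
      rw [mem_ball_iff_norm, add_sub_cancel_left, norm_smul, Real.norm_of_nonneg (by positivity),
        inv_mul_lt_iff₀ ht1]
      rw [mem_ball_iff_norm] at hy
      nlinarith)
    convert hC hz hx ht1.le ht0 (by ring) using 1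
    simp only [q, ← ht_def]
    match_scalars <;> (field_simp; try ring)
  have hdisj : (Finset.range N : Set ℕ).PairwiseDisjoint fun i => Metric.ball (q i) (r / 2) := by
    intro i _ j _ hij
    refine Metric.ball_disjoint_ball ?_
    have h1 : (1 : ℝ) ≤ |(i : ℝ) - j| := by
      have := Int.one_le_abs (sub_ne_zero.mpr (Nat.cast_injective.ne hij : (i : ℤ) ≠ j))
      exact_mod_cast this
    have hq : q i - q j = (((i : ℝ) - j) * r / R) • (x - p) := by
      simp only [q]
      module
    rw [dist_eq_norm, hq, norm_smul, ← hR_def, Real.norm_eq_abs, abs_div, abs_mul,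
      abs_of_pos hR, abs_of_pos hr, div_mul_cancel₀ _ hR.ne']
    nlinarith
  have hle : μ (⋃ i ∈ Finset.range N, Metric.ball (q i) (r / 2)) ≤ μ C :=
    measure_mono (Set.iUnion₂_subset hsub)
  rw [measure_biUnion_finset hdisj fun _ _ => measurableSet_ball] at hle
  simp only [Measure.addHaar_ball_center, Finset.sum_const, Finset.card_range,
    nsmul_eq_mul] at hle
  rw [Measure.addHaar_ball_center] at hN
  exact hle.not_gt hN

end NormedSpace

section InnerProductSpace

variable {E : Type*} [NormedAddCommGroup E] [InnerProductSpace ℝ E]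

/-- The polar of `A` with respect to the point `o`. -/
def polarAt (o : E) (A : Set E) : Set E :=
  {u | ∀ a ∈ A, inner ℝ u (a - o) ≤ 1}

lemma isClosed_polarAt (o : E) (A : Set E) : IsClosed (polarAt o A) := by
  simp only [polarAt, Set.ofPred_forall]
  exact isClosed_biInter fun a _ => isClosed_le (by fun_prop) continuous_const

lemma zero_mem_polarAt (o : E) (A : Set E) : (0 : E) ∈ polarAt o A := by
  simp [polarAt]

lemma polarAt_subset_closedBall {o : E} {A : Set E} {r : ℝ} (hr : 0 < r)
    (h : Metric.closedBall o r ⊆ A) : polarAt o A ⊆ Metric.closedBall 0 r⁻¹ := by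
  intro u hu
  rw [mem_closedBall_zero_iff]
  rcases eq_or_ne u 0 with rfl | hu0
  · simpa using hr.le
  have hn : 0 < ‖u‖ := norm_pos_iff.mpr hu0
  have hmem : o + (r * ‖u‖⁻¹) • u ∈ A := h (by
    simp [norm_smul, abs_of_pos hr, hn.ne'])
  have key := hu _ hmem
  rw [add_sub_cancel_left, inner_smul_right, real_inner_self_eq_norm_sq] at key
  rw [le_inv_comm₀ hn hr, inv_eq_one_div, le_div_iff₀ hn]
  calc r * ‖u‖ = r * ‖u‖⁻¹ * ‖u‖ ^ 2 := by field_simp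
    _ ≤ 1 := key

lemma exists_mem_polarAt_one_lt [CompleteSpace E] {o x : E} {A : Set E} (hA : IsClosed A)
    (hconv : Convex ℝ A) (ho : o ∈ A) (hx : x ∉ A) :
    ∃ u ∈ polarAt o A, 1 < inner ℝ u (x - o) := by
  obtain ⟨f, c, hfA, hfx⟩ := geometric_hahn_banach_closed_point hconv hA hx
  have hc : 0 < c - f o := sub_pos.mpr (hfA o ho)
  refine ⟨(c - f o)⁻¹ • (InnerProductSpace.toDual ℝ E).symm f, fun a ha => ?_, ?_⟩
  · rw [real_inner_smul_left, InnerProductSpace.toDual_symm_apply, map_sub, inv_mul_le_one₀ hc]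
    linarith [hfA a ha]
  · rw [real_inner_smul_left, InnerProductSpace.toDual_symm_apply, map_sub, inv_mul_eq_div,
      one_lt_div hc]
    linarith

/-- Minkowski's measure of asymmetry is at most the dimension. -/
lemma exists_center_of_isCompact_convex [FiniteDimensional ℝ E] {C : Set E} (hC : IsCompact C)
    (hconv : Convex ℝ C) (hne : C.Nonempty) (hd : 0 < finrank ℝ E) :
    ∃ o ∈ C, ∀ x ∈ C, o + (finrank ℝ E : ℝ)⁻¹ • (o - x) ∈ C := by
  classical
  set d := finrank ℝ E
  have hd0 : (0 : ℝ) < d := by exact_mod_cast hd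
  obtain ⟨c₀, hc₀⟩ := hne
  let F : C → Set E := fun x =>
    (fun y => ((d : ℝ) + 1)⁻¹ • (x : E) + ((d : ℝ) / (d + 1)) • y) '' C
  have hF : (⋂ x, F x).Nonempty := by
    refine Convex.helly_theorem_compact' (𝕜 := ℝ) (fun x => hconv.affinity _ _)
      (fun x => hC.image (by fun_prop)) fun I hI => ?_
    rcases I.eq_empty_or_nonempty with rfl | hIne
    · exact ⟨c₀, by simp⟩
    have : Nonempty I := hIne.to_subtype
    obtain ⟨f⟩ : Nonempty (I ↪ Fin (d + 1)) :=
      Function.Embedding.nonempty_of_card_le (by simpa using hI)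
    let g := Function.invFun f
    have hg : Function.Surjective g := Function.invFun_surjective f.injective
    refine ⟨((d : ℝ) + 1)⁻¹ • ∑ k, ((g k : C) : E), Set.mem_iInter₂.mpr fun x hx => ?_⟩
    obtain ⟨k, hk⟩ := hg ⟨x, hx⟩
    refine ⟨∑ j ∈ Finset.univ.erase k, (d : ℝ)⁻¹ • ((g j : C) : E),
      hconv.sum_mem (fun _ _ => by positivity) ?_ fun j _ => (g j : C).2, ?_⟩
    · simp [Finset.card_erase_of_mem, hd0.ne']
    · have hx' : (x : E) = ((g k : C) : E) := by rw [hk]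
      simp only
      rw [hx', ← Finset.smul_sum, smul_smul, ← Finset.add_sum_erase _ _ (Finset.mem_univ k),
        smul_add]
      congr 2
      field_simp
  obtain ⟨o, ho⟩ := hF
  have key : ∀ x ∈ C, o + (d : ℝ)⁻¹ • (o - x) ∈ C := by
    intro x hx
    obtain ⟨y, hy, rfl⟩ := Set.mem_iInter.mp ho ⟨x, hx⟩
    convert hy using 1
    simp only
    match_scalars <;> (field_simp; try ring)
  refine ⟨o, ?_, key⟩
  convert hconv (key c₀ hc₀) hc₀ (a := (d : ℝ) / (d + 1)) (b := 1 / ((d : ℝ) + 1))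
    (by positivity) (by positivity) (by field_simp) using 1
  match_scalars <;> (field_simp; try ring)

/-- A basis of maximal determinant inside a compact spanning set. -/
lemma exists_basis_mem_abs_repr_le_one [FiniteDimensional ℝ E] {T : Set E} (hT : IsCompact T)
    (hspan : Submodule.span ℝ T = ⊤) :
    ∃ b : Basis (Fin (finrank ℝ E)) ℝ E, (∀ i, b i ∈ T) ∧ ∀ u ∈ T, ∀ i, |b.repr u i| ≤ 1 := by
  let e := finBasis ℝ E
  obtain ⟨s, hsT, hs, hli⟩ := exists_linearIndependent ℝ T
  let b₀ : Basis s ℝ E := Basis.mk hli (by simp [hs, hspan])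
  have : Fintype s := FiniteDimensional.fintypeBasisIndex b₀
  let b₁ := b₀.reindex (Fintype.equivFinOfCardEq (finrank_eq_card_basis b₀).symm)
  have hb₁ : ∀ i, b₁ i ∈ T := fun i => by simpa [b₁, b₀] using hsT (Subtype.mem _)
  have hcont : Continuous fun v : Fin (finrank ℝ E) → E => |e.det v| := by
    refine continuous_abs.comp ?_
    change Continuous fun v => (e.toMatrix v).det
    refine Continuous.matrix_det (continuous_matrix fun i j => ?_)
    exact (LinearMap.continuous_of_finiteDimensional (e.coord i)).comp (continuous_apply j)
  obtain ⟨v, hv, hmax⟩ := (isCompact_univ_pi fun _ : Fin (finrank ℝ E) => hT).exists_isMaxOn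
    ⟨b₁, fun i _ => hb₁ i⟩ hcont.continuousOn
  have hv0 : 0 < |e.det v| :=
    (abs_pos.mpr (e.isUnit_det b₁).ne_zero).trans_le (hmax fun i _ => hb₁ i)
  obtain ⟨hvli, hvspan⟩ := e.is_basis_iff_det.mpr (abs_pos.mp hv0).isUnit
  let b : Basis _ ℝ E := Basis.mk hvli hvspan.ge
  have hbv : ⇑b = v := Basis.coe_mk _ _
  refine ⟨b, fun i => by simpa [hbv] using hv i trivial, fun u hu i => ?_⟩
  have hdet : e.det (Function.update v i u) = e.det v * b.repr u i := by
    have h1 : b.det (Function.update v i u) = b.repr u i := by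
      rw [Basis.det_apply, ← hbv, Basis.toMatrix_update, Basis.toMatrix_self,
        ← Matrix.cramer_apply, Matrix.cramer_one]
      rfl
    rw [e.det.eq_smul_basis_det b, AlternatingMap.smul_apply, h1, hbv]
    simp [← hbv, Basis.det_self]
  have hle : |e.det (Function.update v i u)| ≤ |e.det v| := hmax fun j _ => by
    rcases eq_or_ne j i with rfl | hj
    · simpa using hu
    · simpa [hj] using hv j trivial
  rw [hdet, abs_mul] at hle
  exact le_of_mul_le_mul_left (by simpa using hle) hv0

lemma exists_closedBall_subset_of_center {C : Set E} (hconv : Convex ℝ C)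
    (hint : (interior C).Nonempty) {c : ℝ} (hc : 0 < c) {o : E}
    (ho : ∀ x ∈ C, o + c⁻¹ • (o - x) ∈ C) : ∃ r > 0, Metric.closedBall o r ⊆ C := by
  obtain ⟨p, hp⟩ := hint
  obtain ⟨ε, hε, hball⟩ := Metric.nhds_basis_closedBall.mem_iff.mp (mem_interior_iff_mem_nhds.mp hp)
  refine ⟨ε / (c + 1), by positivity, fun y hy => ?_⟩
  have hmem : p + (c + 1) • (y - o) ∈ C := hball (by
    rw [mem_closedBall_iff_norm] at hy ⊢
    rw [add_sub_cancel_left, norm_smul, Real.norm_of_nonneg (by positivity)]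
    rwa [le_div_iff₀' (by positivity)] at hy)
  convert hconv hmem (ho p (interior_subset hp)) (a := 1 / (c + 1)) (b := c / (c + 1))
    (by positivity) (by positivity) (by field_simp; ring) using 1
  match_scalars <;> (field_simp; try ring)

/-- Up to a homothety of ratio `d ^ 2 + 2 * d`, a bounded intersection of closed convex sets is
determined by at most `2 * d` of them. -/
lemma exists_subset_card_le_sInter_subset_homothety [FiniteDimensional ℝ E]
    (hd : 0 < finrank ℝ E) (F : Finset (Set E)) (hF : ∀ A ∈ F, IsClosed A ∧ Convex ℝ A)
    (hint : (interior (⋂₀ (F : Set (Set E)))).Nonempty)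
    (hbdd : Bornology.IsBounded (⋂₀ (F : Set (Set E)))) :
    ∃ G ⊆ F, G.card ≤ 2 * finrank ℝ E ∧ ∃ o : E, ⋂₀ (G : Set (Set E)) ⊆
      AffineMap.homothety o ((finrank ℝ E : ℝ) ^ 2 + 2 * finrank ℝ E) '' ⋂₀ (F : Set (Set E)) := by
  classical
  set P := ⋂₀ (F : Set (Set E))
  set d := finrank ℝ E
  have hd0 : (0 : ℝ) < d := by exact_mod_cast hd
  have hPconv : Convex ℝ P := convex_sInter fun A hA => (hF A hA).2
  have hPcomp : IsCompact P :=
    Metric.isCompact_of_isClosed_isBounded (isClosed_sInter fun A hA => (hF A hA).1) hbdd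
  have hPsub : ∀ A ∈ F, P ⊆ A := fun A hA => Set.sInter_subset_of_mem hA
  obtain ⟨o, ho, hcenter⟩ :=
    exists_center_of_isCompact_convex hPcomp hPconv (hint.mono interior_subset) hd
  obtain ⟨r, hr, hball⟩ := exists_closedBall_subset_of_center hPconv hint hd0 hcenter
  let T : Set E := ⋃ A ∈ F, polarAt o A
  have hTmem : ∀ u ∈ T, ∃ A ∈ F, u ∈ polarAt o A := fun u hu => by simpa [T] using hu
  have hTP : ∀ u ∈ T, u ∈ polarAt o P := fun u hu a ha => by
    obtain ⟨A, hA, huA⟩ := hTmem u hu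
    exact huA a (hPsub A hA ha)
  have hbipolar : ∀ x ∉ P, ∃ u ∈ T, 1 < inner ℝ u (x - o) := fun x hx => by
    obtain ⟨A, hA, hxA⟩ : ∃ A ∈ F, x ∉ A := by simpa [P] using hx
    obtain ⟨u, hu, hux⟩ :=
      exists_mem_polarAt_one_lt (hF A hA).1 (hF A hA).2 (hPsub A hA ho) hxA
    exact ⟨u, Set.mem_biUnion hA hu, hux⟩
  have hTcomp : IsCompact T := F.isCompact_biUnion fun A hA =>
    (isCompact_closedBall 0 r⁻¹).of_isClosed_subset (isClosed_polarAt o A)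
      (polarAt_subset_closedBall hr (hball.trans (hPsub A hA)))
  obtain ⟨R, hR⟩ := hbdd.subset_closedBall o
  have hspan : Submodule.span ℝ T = ⊤ := by
    rw [← Submodule.orthogonal_eq_bot_iff, Submodule.eq_bot_iff]
    intro x hx
    by_contra hx0
    have hmem : o + ((|R| + 1) * ‖x‖⁻¹) • x ∈ P := by
      by_contra hnot
      obtain ⟨u, hu, hux⟩ := hbipolar _ hnot
      rw [add_sub_cancel_left, inner_smul_right,
        (Submodule.mem_orthogonal _ x).mp hx u (Submodule.subset_span hu)] at hux
      linarith
    have hle := hR hmem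
    rw [mem_closedBall_iff_norm, add_sub_cancel_left, norm_smul, norm_mul, norm_inv, norm_norm,
      inv_mul_cancel_right₀ (norm_ne_zero_iff.mpr hx0), Real.norm_of_nonneg (by positivity)] at hle
    linarith [le_abs_self R]
  obtain ⟨b, hbT, hb⟩ := exists_basis_mem_abs_repr_le_one hTcomp hspan
  have h0T : (0 : E) ∈ T := by
    obtain ⟨A, hA, -⟩ := hTmem _ (hbT ⟨0, hd⟩)
    exact Set.mem_biUnion hA (zero_mem_polarAt o A)
  have hq : -((d : ℝ) ^ 2)⁻¹ • ∑ i, b i ∈ closure (convexHull ℝ T) := by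
    by_contra hq
    obtain ⟨x, hx, hxq⟩ := exists_mem_polarAt_one_lt isClosed_closure
      (convex_convexHull ℝ T).closure (subset_closure (subset_convexHull ℝ T h0T)) hq
    have hxP : o + x ∈ P := by
      by_contra hnot
      obtain ⟨u, hu, hux⟩ := hbipolar _ hnot
      have := hx u (subset_closure (subset_convexHull ℝ T hu))
      rw [sub_zero, real_inner_comm] at this
      rw [add_sub_cancel_left] at hux
      exact this.not_gt hux
    have hbx : ∀ i, -inner ℝ x (b i) ≤ d := fun i => by
      have := hTP _ (hbT i) _ (hcenter _ hxP)
      rw [add_sub_cancel_left, sub_add_cancel_left, inner_smul_right, inner_neg_right,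
        inv_mul_le_iff₀ hd0, mul_one, real_inner_comm] at this
      exact this
    rw [sub_zero, inner_smul_right, inner_sum, neg_mul, ← mul_neg, ← Finset.sum_neg_distrib,
      lt_inv_mul_iff₀ (by positivity), mul_one] at hxq
    have hsum := Finset.sum_le_sum fun i (_ : i ∈ Finset.univ) => hbx i
    rw [Finset.sum_const, Finset.card_univ, Fintype.card_fin, nsmul_eq_mul] at hsum
    change _ ≤ (d : ℝ) * d at hsum
    nlinarith
  obtain ⟨μ, v, hvT, hμ, hμ1, hv⟩ := exists_sum_smul_eq_of_mem_closure_convexHull hTcomp hq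
  choose A hAF hA using fun i => hTmem _ (hbT i)
  choose B hBF hB using fun i => hTmem _ (hvT i)
  refine ⟨Finset.univ.image A ∪ Finset.univ.image B, ?_, ?_, o, fun x hx => ?_⟩
  · simpa [Finset.union_subset_iff, Finset.image_subset_iff] using ⟨hAF, hBF⟩
  · refine (Finset.card_union_le _ _).trans ?_
    have h1 := Finset.card_image_le (s := Finset.univ) (f := A)
    have h2 := Finset.card_image_le (s := Finset.univ) (f := B)
    rw [Finset.card_univ, Fintype.card_fin] at h1 h2
    omega
  have hbx : ∀ i, inner ℝ (b i) (x - o) ≤ 1 := fun i =>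
    hA i x (hx (A i) (by simp))
  have hvx : ∀ i, inner ℝ (v i) (x - o) ≤ 1 := fun i =>
    hB i x (hx (B i) (by simp))
  have hs : -∑ i, inner ℝ (b i) (x - o) ≤ (d : ℝ) ^ 2 := by
    have h1 : -(((d : ℝ) ^ 2)⁻¹ * ∑ i, inner ℝ (b i) (x - o)) =
        ∑ i, μ i * inner ℝ (v i) (x - o) := by
      rw [← sum_inner, ← neg_mul, ← real_inner_smul_left, ← hv, sum_inner]
      simp only [real_inner_smul_left]
    have h2 : ∑ i, μ i * inner ℝ (v i) (x - o) ≤ 1 :=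
      (Finset.sum_le_sum fun i _ => mul_le_of_le_one_right (hμ i) (hvx i)).trans hμ1
    rw [← h1, ← mul_neg, inv_mul_le_iff₀ (by positivity), mul_one] at h2
    exact h2
  set ρ := (d : ℝ) ^ 2 + 2 * d
  have hρ : 0 < ρ := by positivity
  refine ⟨o + ρ⁻¹ • (x - o), ?_, ?_⟩
  · by_contra hnot
    obtain ⟨u, hu, hux⟩ := hbipolar _ hnot
    rw [add_sub_cancel_left, inner_smul_right, lt_inv_mul_iff₀ hρ, mul_one, ← b.sum_repr u,
      sum_inner] at hux
    have hle : ∑ i, (inner ℝ (b.repr u i • b i) (x - o) + inner ℝ (b i) (x - o)) ≤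
        ∑ _i : Fin (finrank ℝ E), (2 : ℝ) := Finset.sum_le_sum fun i _ => by
      rw [real_inner_smul_left]
      obtain ⟨h1, h2⟩ := abs_le.mp (hb u hu i)
      nlinarith [hbx i]
    rw [Finset.sum_add_distrib, Finset.sum_const, Finset.card_univ, Fintype.card_fin,
      nsmul_eq_mul] at hle
    change _ ≤ (d : ℝ) * 2 at hle
    linarith
  · simp [AffineMap.homothety_apply, smul_smul, hρ.ne']

end InnerProductSpace

end ConvexGeometry

lemma two_pow_mul_factorial_le_succ_pow (d : ℕ) : 2 ^ d * d.factorial ≤ (d + 1) ^ d := by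
  induction d with
  | zero => simp
  | succ d ih =>
    have h : 2 * (d + 1) ^ (d + 1) ≤ (d + 1 + 1) ^ (d + 1) := by
      have h1 := one_add_mul_le_pow (a := ((d : ℝ) + 1)⁻¹)
        (by have : (0 : ℝ) ≤ ((d : ℝ) + 1)⁻¹ := by positivity
            linarith) (d + 1)
      have h2 : (1 : ℝ) + ((d : ℝ) + 1)⁻¹ = (d + 1 + 1) / (d + 1) := by field_simp
      rw [h2, div_pow, le_div_iff₀ (by positivity)] at h1
      have h3 : (1 : ℝ) + ((d + 1 : ℕ) : ℝ) * ((d : ℝ) + 1)⁻¹ = 2 := by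
        push_cast
        field_simp
        norm_num
      rw [h3] at h1
      exact_mod_cast h1
    calc 2 ^ (d + 1) * (d + 1).factorial = 2 * (d + 1) * (2 ^ d * d.factorial) := by
          rw [Nat.factorial_succ]; ring
      _ ≤ 2 * (d + 1) * (d + 1) ^ d := Nat.mul_le_mul_left _ ih
      _ = 2 * (d + 1) ^ (d + 1) := by ring
      _ ≤ _ := h

lemma add_two_pow_mul_factorial_le {d : ℕ} (hd : 0 < d) :
    (d + 2) ^ (2 * d) * d.factorial ≤ (d + 1) ^ (3 * d + 1) := by
  obtain rfl | h : d = 1 ∨ 2 ≤ d := by omega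
  · norm_num
  calc (d + 2) ^ (2 * d) * d.factorial ≤ (2 * (d + 1) ^ 2) ^ d * d.factorial := by
        rw [pow_mul]
        gcongr
        nlinarith
    _ = (d + 1) ^ (2 * d) * (2 ^ d * d.factorial) := by rw [mul_pow, ← pow_mul]; ring
    _ ≤ (d + 1) ^ (2 * d) * (d + 1) ^ d :=
        Nat.mul_le_mul_left _ (two_pow_mul_factorial_le_succ_pow d)
    _ = (d + 1) ^ (3 * d) := by rw [← pow_add]; congr 1; ring
    _ ≤ _ := Nat.pow_le_pow_right (by omega) (by omega)

lemma sq_add_two_mul_pow_le {d : ℕ} (hd : 0 < d) :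
    ((d : ℝ) ^ 2 + 2 * d) ^ d ≤ (d : ℝ) ^ d * ((d : ℝ) + 1) ^ ((3 * (d : ℝ) + 1) / 2) *
      (d.factorial : ℝ) ^ (-(1 / 2 : ℝ)) := by
  have hfac : (0 : ℝ) < d.factorial := by exact_mod_cast d.factorial_pos
  have key : ((d : ℝ) + 2) ^ d * (d.factorial : ℝ) ^ (1 / 2 : ℝ) ≤
      ((d : ℝ) + 1) ^ ((3 * (d : ℝ) + 1) / 2) := by
    rw [← pow_le_pow_iff_left₀ (by positivity) (by positivity) two_ne_zero, mul_pow,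
      ← Real.rpow_mul_natCast hfac.le, ← Real.rpow_mul_natCast (by positivity), ← pow_mul]
    have h := add_two_pow_mul_factorial_le hd
    have h3 : (3 * (d : ℝ) + 1) / 2 * (2 : ℕ) = (3 * d + 1 : ℕ) := by push_cast; ring
    have h4 : (1 / 2 : ℝ) * (2 : ℕ) = 1 := by norm_num
    rw [h3, h4, Real.rpow_one, Real.rpow_natCast, mul_comm d 2]
    exact_mod_cast h
  rw [Real.rpow_neg hfac.le, ← div_eq_mul_inv, le_div_iff₀ (by positivity),
    show (d : ℝ) ^ 2 + 2 * d = d * (d + 2) by ring, mul_pow, mul_assoc]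
  gcongr

/-- Quantitative volume Helly theorem with the explicit constant
`d^d · (d+1)^((3d+1)/2) · (d!)^(−1/2)` obtained in the proof. -/
theorem quantitative_volume_helly_explicit (d : ℕ)
    (F : Finset (Set (EuclideanSpace ℝ (Fin d))))
    (hF : ∀ A ∈ F, IsClosed A ∧ Convex ℝ A)
    (hpos : 0 < volume (⋂₀ (F : Set (Set (EuclideanSpace ℝ (Fin d))))))
    (hfin : volume (⋂₀ (F : Set (Set (EuclideanSpace ℝ (Fin d))))) < ⊤) :
    ∃ G ⊆ F, G.card ≤ 2 * d ∧
      volume (⋂₀ (G : Set (Set (EuclideanSpace ℝ (Fin d))))) ≤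
        ENNReal.ofReal ((d : ℝ) ^ d * ((d : ℝ) + 1) ^ ((3 * (d : ℝ) + 1) / 2) *
            ((d.factorial : ℝ)) ^ (-(1 / 2 : ℝ))) *
          volume (⋂₀ (F : Set (Set (EuclideanSpace ℝ (Fin d))))) := by
  rcases Nat.eq_zero_or_pos d with rfl | hd
  · refine ⟨∅, by simp, by simp, ?_⟩
    obtain ⟨x, hx⟩ := nonempty_of_measure_ne_zero hpos.ne'
    have huniv : ⋂₀ (F : Set (Set (EuclideanSpace ℝ (Fin 0)))) = Set.univ :=
      Set.eq_univ_of_forall fun y => Subsingleton.elim x y ▸ hx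
    rw [huniv]
    simp
  have hconv := convex_sInter fun A hA => (hF A hA).2
  have hint : (interior (⋂₀ (F : Set (Set (EuclideanSpace ℝ (Fin d)))))).Nonempty := by
    by_contra hne
    rw [Set.not_nonempty_iff_eq_empty] at hne
    refine hpos.ne' (measure_mono_null (fun x hx => ?_) (hconv.addHaar_frontier volume))
    rw [frontier, hne, Set.sdiff_empty]
    exact subset_closure hx
  have hrank : Module.finrank ℝ (EuclideanSpace ℝ (Fin d)) = d := finrank_euclideanSpace_fin
  obtain ⟨G, hGF, hG, o, hsub⟩ := exists_subset_card_le_sInter_subset_homothety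
    (by rwa [hrank]) F hF hint (hconv.isBounded_of_measure_ne_top hint hfin.ne)
  rw [hrank] at hG hsub
  refine ⟨G, hGF, hG, (measure_mono hsub).trans ?_⟩
  rw [Measure.addHaar_image_homothety, hrank, abs_of_nonneg (by positivity)]
  gcongr
  exact sq_add_two_mul_pow_le hd
end

section
/- (Dvoretzky–Rogers lemma.) Assume that unit vectors w_1, …, w_m on the boundary of the Euclidean unit ball B of R^d and positive weights c_1, …, c_m satisfy Σ_{i=1}^m c_i (w_i ⊗ w_i) = I, where I is the identity operator on R^d. Then there exists an orthonormal basis z_1, …, z_d of R^d and a subset {v_1, …, v_d} of {w_1, …, w_m} such that for every i = 1, …, d one has v_i ∈ span{z_1, …, z_i} and √((d−i+1)/d) ≤ ⟨v_i, z_i⟩ ≤ 1. -/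
open scoped RealInnerProductSpace

section DecompositionOfIdentity

variable {E : Type*} [NormedAddCommGroup E] [InnerProductSpace ℝ E]
  {ι : Type*} [Fintype ι] {w : ι → E} {c : ι → ℝ}

theorem sum_mul_inner_sq_eq_norm_sq (h : ∀ x : E, ∑ i, c i • (⟪w i, x⟫ • w i) = x) (x : E) :
    ∑ i, c i * ⟪w i, x⟫ ^ 2 = ‖x‖ ^ 2 := by
  have hx := congrArg (⟪·, x⟫) (h x)
  simp only [sum_inner, real_inner_smul_left, real_inner_self_eq_norm_sq] at hx
  simpa only [pow_two] using hx

variable [FiniteDimensional ℝ E]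

/-- The weighted squared norms of the projections onto `K` add up to the trace of the
projection. -/
theorem sum_mul_norm_orthogonalProjectionOnto_sq (h : ∀ x : E, ∑ i, c i • (⟪w i, x⟫ • w i) = x)
    (K : Submodule ℝ E) :
    ∑ i, c i * ‖K.orthogonalProjectionOnto (w i)‖ ^ 2 = Module.finrank ℝ K := by
  let b := stdOrthonormalBasis ℝ K
  have key (i : ι) : c i * ‖K.orthogonalProjectionOnto (w i)‖ ^ 2 =
      ∑ j, c i * ⟪w i, (b j : E)⟫ ^ 2 := by
    rw [← b.sum_sq_norm_inner_right, Finset.mul_sum]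
    refine Finset.sum_congr rfl fun j _ => ?_
    rw [Real.norm_eq_abs, sq_abs, Submodule.inner_orthogonalProjectionOnto_eq_of_mem_left,
      real_inner_comm]
  have hb (j) : ‖(b j : E)‖ = 1 := b.orthonormal.1 j
  simp_rw [key]
  rw [Finset.sum_comm]
  simp [sum_mul_inner_sq_eq_norm_sq h, hb]

theorem exists_le_norm_orthogonalProjectionOnto_sq (hw : ∀ i, ‖w i‖ = 1) (hc : ∀ i, 0 < c i)
    (h : ∀ x : E, ∑ i, c i • (⟪w i, x⟫ • w i) = x) (hE : 0 < Module.finrank ℝ E)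
    (K : Submodule ℝ E) :
    ∃ i, (Module.finrank ℝ K : ℝ) / Module.finrank ℝ E ≤ ‖K.orthogonalProjectionOnto (w i)‖ ^ 2 := by
  have hsum : ∑ i, c i = Module.finrank ℝ E := by
    have htop (x : E) : ‖(⊤ : Submodule ℝ E).orthogonalProjectionOnto x‖ = ‖x‖ :=
      congrArg norm (Submodule.starProjection_eq_self_iff.2 (Submodule.mem_top : x ∈ ⊤))
    simpa only [htop, hw, one_pow, mul_one, finrank_top] using
      sum_mul_norm_orthogonalProjectionOnto_sq h ⊤
  have hE' : (0 : ℝ) < Module.finrank ℝ E := by exact_mod_cast hE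
  by_contra! hlt
  have hne : (Finset.univ : Finset ι).Nonempty := by
    by_contra hemp
    rw [Finset.not_nonempty_iff_eq_empty] at hemp
    rw [hemp, Finset.sum_empty] at hsum
    exact hE'.ne hsum
  have := Finset.sum_lt_sum_of_nonempty hne fun i _ => mul_lt_mul_of_pos_left (hlt i) (hc i)
  rw [sum_mul_norm_orthogonalProjectionOnto_sq h, ← Finset.sum_mul, hsum,
    mul_div_cancel₀ _ hE'.ne'] at this
  exact this.false

theorem exists_unit_mem_orthogonal (hw : ∀ i, ‖w i‖ = 1) (hc : ∀ i, 0 < c i)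
    (h : ∀ x : E, ∑ i, c i • (⟪w i, x⟫ • w i) = x)
    (S : Submodule ℝ E) (hS : Module.finrank ℝ S < Module.finrank ℝ E) :
    ∃ (z : E) (i : ι), z ∈ Sᗮ ∧ ‖z‖ = 1 ∧ w i ∈ S ⊔ Submodule.span ℝ {z} ∧
      √(((Module.finrank ℝ E - Module.finrank ℝ S : ℕ) : ℝ) / Module.finrank ℝ E) ≤ ⟪w i, z⟫ := by
  obtain ⟨i, hi⟩ := exists_le_norm_orthogonalProjectionOnto_sq hw hc h (by omega) Sᗮ
  have hrank : Module.finrank ℝ Sᗮ = Module.finrank ℝ E - Module.finrank ℝ S := by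
    have := S.finrank_add_finrank_orthogonal
    omega
  rw [hrank] at hi
  set p : Sᗮ := Sᗮ.orthogonalProjectionOnto (w i) with hp
  have hpos : 0 < ‖p‖ := by
    have : (0 : ℝ) < ((Module.finrank ℝ E - Module.finrank ℝ S : ℕ) : ℝ) / Module.finrank ℝ E := by
      apply div_pos <;> exact_mod_cast (by omega)
    exact (norm_nonneg p).lt_of_ne' fun h0 => by simp [h0] at hi; linarith
  have hsplit : w i = (S.orthogonalProjectionOnto (w i) : E) + p :=
    (S.starProjection_add_starProjection_orthogonal (w i)).symm
  refine ⟨‖p‖⁻¹ • (p : E), i, Sᗮ.smul_mem _ p.2, ?_, ?_, ?_⟩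
  · rw [norm_smul, norm_inv, norm_norm, Submodule.coe_norm, inv_mul_cancel₀]
    exact hpos.ne'
  · rw [hsplit]
    refine Submodule.add_mem_sup (Subtype.prop _) (Submodule.mem_span_singleton.2 ⟨‖p‖, ?_⟩)
    rw [smul_smul, mul_inv_cancel₀ hpos.ne', one_smul]
  · have hin : ⟪w i, (p : E)⟫ = ‖p‖ ^ 2 := by
      rw [← Submodule.inner_orthogonalProjectionOnto_eq_of_mem_right, ← hp,
        real_inner_self_eq_norm_sq]
    rw [real_inner_smul_right, hin, pow_two, inv_mul_cancel_left₀ hpos.ne']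
    exact Real.sqrt_le_iff.2 ⟨norm_nonneg _, hi⟩

end DecompositionOfIdentity

theorem Submodule.exists_seq_eq_span {K V : Type*} [Ring K] [AddCommGroup V] [Module K V]
    (f : Submodule K V → V) :
    ∃ z : ℕ → V, ∀ n, z n = f (span K (z '' Set.Iio n)) := by
  let S : ℕ → Submodule K V := fun n => Nat.rec ⊥ (fun _ T => T ⊔ span K {f T}) n
  have hS (n : ℕ) : S n = span K ((fun k => f (S k)) '' Set.Iio n) := by
    induction n with
    | zero => simp [S]
    | succ n ih =>
      have : Set.Iio (n + 1) = insert n (Set.Iio n) := by ext; simp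
      rw [this, Set.image_insert_eq, span_insert, ← ih, sup_comm]
  exact ⟨fun k => f (S k), fun n => congrArg f (hS n)⟩

/-- Dvoretzky–Rogers lemma: if unit vectors `w 1, …, w m` with positive weights
`c 1, …, c m` satisfy `∑ c i (w i ⊗ w i) = I`, then there is an orthonormal basis
`z 1, …, z d` and vectors `v 1, …, v d` among the `w j` with `v i ∈ span{z 1,…,z i}`
and `√((d−i+1)/d) ≤ ⟨v i, z i⟩ ≤ 1` (here indices are `0`-based, so `d−i+1`
becomes `d − i`). -/
theorem dvoretzky_rogers (d m : ℕ) (w : Fin m → EuclideanSpace ℝ (Fin d))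
    (c : Fin m → ℝ) (hw : ∀ i, ‖w i‖ = 1) (hc : ∀ i, 0 < c i)
    (hdecomp : ∀ x : EuclideanSpace ℝ (Fin d),
      ∑ i, c i • (⟪w i, x⟫ • w i) = x) :
    ∃ (z v : Fin d → EuclideanSpace ℝ (Fin d)),
      Orthonormal ℝ z ∧
      Submodule.span ℝ (Set.range z) = ⊤ ∧
      (∀ i : Fin d, ∃ j : Fin m, v i = w j) ∧
      (∀ i : Fin d, v i ∈ Submodule.span ℝ (z '' {j : Fin d | j ≤ i})) ∧
      (∀ i : Fin d,
        Real.sqrt (((d - (i : ℕ) : ℕ) : ℝ) / (d : ℝ)) ≤ ⟪v i, z i⟫ ∧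
        ⟪v i, z i⟫ ≤ 1) := by
  have step (S : Submodule ℝ (EuclideanSpace ℝ (Fin d))) :
      ∃ (z v : EuclideanSpace ℝ (Fin d)), Module.finrank ℝ S < d →
        (∃ j, v = w j) ∧ z ∈ Sᗮ ∧ ‖z‖ = 1 ∧ v ∈ S ⊔ Submodule.span ℝ {z} ∧
          √(((d - Module.finrank ℝ S : ℕ) : ℝ) / d) ≤ ⟪v, z⟫ := by
    by_cases hS : Module.finrank ℝ S < d
    · obtain ⟨z, i, hz⟩ := exists_unit_mem_orthogonal hw hc hdecomp S (by simpa using hS)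
      rw [finrank_euclideanSpace_fin] at hz
      exact ⟨z, w i, fun _ => ⟨⟨i, rfl⟩, hz⟩⟩
    · exact ⟨0, 0, fun h => absurd h hS⟩
  choose f g hfg using step
  obtain ⟨z, hz⟩ := Submodule.exists_seq_eq_span f
  let S (n : ℕ) := Submodule.span ℝ (z '' Set.Iio n)
  have hrank (n : ℕ) : Module.finrank ℝ (S n) ≤ n := by
    have hspan := finrank_span_finset_le_card (R := ℝ) ((Finset.range n).image z)
    rw [Finset.coe_image, Finset.coe_range] at hspan
    exact hspan.trans (Finset.card_image_le.trans_eq (Finset.card_range n))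
  have hstep (i : Fin d) := hfg (S i) ((hrank i).trans_lt i.2)
  simp_rw [show ∀ n, f (S n) = z n from fun n => (hz n).symm] at hstep
  have hlt {i j : Fin d} (hij : i < j) : ⟪z i, z j⟫ = 0 :=
    (hstep j).2.1 _ (Submodule.subset_span ⟨i, hij, rfl⟩)
  have hortho : Orthonormal ℝ fun i : Fin d => z i := by
    refine ⟨fun i => (hstep i).2.2.1, fun i j hij => ?_⟩
    rcases hij.lt_or_gt with hij | hij
    · exact hlt hij
    · rw [real_inner_comm]
      exact hlt hij
  refine ⟨fun i => z i, fun i => g (S i), hortho, ?_, fun i => (hstep i).1, fun i => ?_,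
    fun i => ⟨?_, ?_⟩⟩
  · exact hortho.linearIndependent.span_eq_top_of_card_eq_finrank' (by simp)
  · refine (sup_le ?_ ?_ : S i ⊔ Submodule.span ℝ {z i} ≤ _) (hstep i).2.2.2.1
    · refine Submodule.span_mono ?_
      rintro _ ⟨k, hk, rfl⟩
      exact ⟨⟨k, lt_trans hk i.2⟩, (le_of_lt hk : k ≤ i), rfl⟩
    · refine Submodule.span_mono ?_
      rintro _ rfl
      exact ⟨i, le_refl i, rfl⟩
  · refine le_trans (Real.sqrt_le_sqrt ?_) (hstep i).2.2.2.2
    gcongr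
    exact hrank i
  · obtain ⟨j, hj⟩ := (hstep i).1
    refine (real_inner_le_norm _ _).trans_eq ?_
    dsimp only
    rw [hj, hw, (hstep i).2.2.1, one_mul]
end

section
/- If unit vectors w_1, …, w_m ∈ bd(B) in R^d and positive weights c_1, …, c_m form a John's decomposition of the identity (i.e. Σ c_i w_i = 0 and Σ c_i (w_i ⊗ w_i) = I), then the polar set {w_1, …, w_m}^* = { y ∈ R^d : ⟨w_i, y⟩ ≤ 1 for all i } is contained in d·B. -/
open scoped RealInnerProductSpace

/-- Taking traces in `∑ i, c i • (w i ⊗ w i) = I` with unit vectors `w i`: the weights sum to the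
dimension. -/
theorem sum_weights_eq_card_of_decomposition {ι κ E : Type*} [Fintype ι] [Fintype κ]
    [NormedAddCommGroup E] [InnerProductSpace ℝ E] (b : OrthonormalBasis κ ℝ E)
    (w : ι → E) (c : ι → ℝ) (hw : ∀ i, ‖w i‖ = 1)
    (hdecomp : ∀ x : E, ∑ i, c i • (⟪w i, x⟫ • w i) = x) :
    ∑ i, c i = Fintype.card κ := by
  have hbasis (j : κ) : ∑ i, c i * ⟪w i, b j⟫ ^ 2 = 1 := by
    have h := congrArg (fun v => ⟪v, b j⟫) (hdecomp (b j))
    simpa [sum_inner, real_inner_smul_left, pow_two] using h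
  have hnorm (i : ι) : ∑ j, ⟪w i, b j⟫ ^ 2 = 1 := by
    rw [b.sum_sq_inner_left, hw, one_pow]
  calc ∑ i, c i = ∑ i, ∑ j, c i * ⟪w i, b j⟫ ^ 2 := by
        simp [← Finset.mul_sum, hnorm]
    _ = Fintype.card κ := by
        rw [Finset.sum_comm]
        simp [hbasis]

/-- If unit vectors `w i` with positive weights `c i` form a John's decomposition
of the identity, then the polar of `{w 1, …, w m}` is contained in `d·B`. -/
theorem john_decomposition_polar_subset (d m : ℕ) (hd : 0 < d)
    (w : Fin m → EuclideanSpace ℝ (Fin d)) (c : Fin m → ℝ)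
    (hw : ∀ i, ‖w i‖ = 1) (hc : ∀ i, 0 < c i)
    (hbal : ∑ i, c i • w i = 0)
    (hdecomp : ∀ x : EuclideanSpace ℝ (Fin d),
      ∑ i, c i • (⟪w i, x⟫ • w i) = x) :
    {y : EuclideanSpace ℝ (Fin d) | ∀ i : Fin m, ⟪w i, y⟫ ≤ 1} ⊆
      Metric.closedBall (0 : EuclideanSpace ℝ (Fin d)) d := by
  rintro y hy
  rw [mem_closedBall_zero_iff]
  have hsum : ∑ i, c i = d := by
    simpa using sum_weights_eq_card_of_decomposition (EuclideanSpace.basisFun (Fin d) ℝ) w c hw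
      hdecomp
  have hlin : ∑ i, c i * ⟪w i, y⟫ = 0 := by
    simpa [sum_inner, real_inner_smul_left] using congrArg (fun v => ⟪v, y⟫) hbal
  have hquad : ∑ i, c i * ⟪w i, y⟫ ^ 2 = ‖y‖ ^ 2 := by
    simpa [sum_inner, real_inner_smul_left, pow_two] using
      congrArg (fun v => ⟪v, y⟫) (hdecomp y)
  have hnonneg : 0 ≤ ∑ i, c i * ((1 - ⟪w i, y⟫) * (‖y‖ + ⟪w i, y⟫)) := by
    refine Finset.sum_nonneg fun i _ => mul_nonneg (hc i).le (mul_nonneg ?_ ?_)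
    · exact sub_nonneg.2 (hy i)
    · have h := neg_le_of_abs_le (abs_real_inner_le_norm (w i) y)
      rw [hw, one_mul] at h
      linarith
  have hexpand : ∑ i, c i * ((1 - ⟪w i, y⟫) * (‖y‖ + ⟪w i, y⟫)) = d * ‖y‖ - ‖y‖ ^ 2 := by
    calc _ = (∑ i, c i) * ‖y‖ + (1 - ‖y‖) * (∑ i, c i * ⟪w i, y⟫)
          - ∑ i, c i * ⟪w i, y⟫ ^ 2 := by
          rw [Finset.sum_mul, Finset.mul_sum, ← Finset.sum_add_distrib, ← Finset.sum_sub_distrib]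
          exact Finset.sum_congr rfl fun i _ => by ring
      _ = _ := by rw [hsum, hlin, hquad]; ring
  by_contra! hlt
  have hd' : (0 : ℝ) < d := by exact_mod_cast hd
  nlinarith
end

section
/- If unit vectors w_1, …, w_m ∈ bd(B) in R^d and positive weights c_1, …, c_m form a John's decomposition of the identity (i.e. Σ c_i w_i = 0 and Σ c_i (w_i ⊗ w_i) = I), then (1/d)·B is contained in the convex hull conv{w_1, …, w_m}. -/
open scoped RealInnerProductSpace

/-- The weights in a decomposition of the identity by unit vectors add up to the dimension. -/
theorem sum_weights_eq_finrank_of_decomposition {ι E : Type*} [Fintype ι]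
    [NormedAddCommGroup E] [InnerProductSpace ℝ E] [FiniteDimensional ℝ E]
    {w : ι → E} {c : ι → ℝ} (hw : ∀ i, ‖w i‖ = 1)
    (hdecomp : ∀ x : E, ∑ i, c i • (⟪w i, x⟫ • w i) = x) :
    ∑ i, c i = Module.finrank ℝ E := by
  have htrace : ∑ i, c i • (innerₗ E (w i)).smulRight (w i) = LinearMap.id := by
    ext x
    simpa using hdecomp x
  simpa [LinearMap.trace_smulRight, hw] using congrArg (LinearMap.trace ℝ E) htrace

/-- If unit vectors `w i` with positive weights `c i` form a John's decomposition
of the identity, then `(1/d)·B` is contained in `conv{w 1, …, w m}`. -/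
theorem john_decomposition_ball_subset_hull (d m : ℕ) (hd : 0 < d)
    (w : Fin m → EuclideanSpace ℝ (Fin d)) (c : Fin m → ℝ)
    (hw : ∀ i, ‖w i‖ = 1) (hc : ∀ i, 0 < c i)
    (hbal : ∑ i, c i • w i = 0)
    (hdecomp : ∀ x : EuclideanSpace ℝ (Fin d),
      ∑ i, c i • (⟪w i, x⟫ • w i) = x) :
    Metric.closedBall (0 : EuclideanSpace ℝ (Fin d)) (1 / d) ⊆
      convexHull ℝ (Set.range w) := by
  intro x hx
  rw [mem_closedBall_zero_iff] at hx
  have hsum : ∑ i, c i = d := by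
    simpa using sum_weights_eq_finrank_of_decomposition hw hdecomp
  have hinner (i : Fin m) : |⟪w i, x⟫| ≤ 1 / d := by
    refine (abs_real_inner_le_norm _ _).trans ?_
    simpa [hw] using hx
  have hbal_inner : ∑ i, c i * ⟪w i, x⟫ = 0 := by
    simpa [sum_inner, real_inner_smul_left] using congrArg (⟪·, x⟫) hbal
  have hx_eq : ∑ i, (c i * (1 / d + ⟪w i, x⟫)) • w i = x := by
    calc
      _ = (1 / d : ℝ) • ∑ i, c i • w i + ∑ i, c i • (⟪w i, x⟫ • w i) := by
        rw [Finset.smul_sum, ← Finset.sum_add_distrib]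
        exact Finset.sum_congr rfl fun i _ => by module
      _ = x := by rw [hbal, hdecomp, smul_zero, zero_add]
  rw [← hx_eq]
  refine (convex_convexHull ℝ _).sum_mem (fun i _ => ?_) ?_
    (fun i _ => subset_convexHull ℝ _ (Set.mem_range_self i))
  · exact mul_nonneg (hc i).le (by linarith [(abs_le.mp (hinner i)).1])
  · simp only [mul_add, Finset.sum_add_distrib, ← Finset.sum_mul, hsum, hbal_inner]
    field_simp
    simp
end

section
/- Let Δ be a d-dimensional simplex in R^d and let E be the ellipsoid of maximal volume contained in Δ. Then vol(E)/vol(Δ) = d! · vol(B) / ( d^{d/2} · (d+1)^{(d+1)/2} ), where B is the Euclidean unit ball of R^d. -/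
open MeasureTheory
open scoped ENNReal

/-- An ellipsoid in `ℝ^d` is the image of the closed Euclidean unit ball under an
invertible affine map. -/
def IsEllipsoid (d : ℕ) (s : Set (EuclideanSpace ℝ (Fin d))) : Prop :=
  ∃ f : EuclideanSpace ℝ (Fin d) ≃ᵃ[ℝ] EuclideanSpace ℝ (Fin d),
    s = f '' Metric.closedBall 0 1

theorem volume_nonneg_sum_le (n : ℕ) (r : ℝ) (hr : 0 ≤ r) :
    volume {x : Fin n → ℝ | (∀ i, 0 ≤ x i) ∧ ∑ i, x i ≤ r} =
      ENNReal.ofReal (r ^ n / n.factorial) := by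
  induction n generalizing r with
  | zero => simp [hr, volume_pi]
  | succ n ih =>
    have hmeas : MeasurableSet {x : Fin (n + 1) → ℝ | (∀ i, 0 ≤ x i) ∧ ∑ i, x i ≤ r} := by
      measurability
    have hpres := (volume_preserving_piFinSuccAbove (fun _ : Fin (n + 1) => ℝ) 0).symm
    rw [← hpres.measure_preimage hmeas.nullMeasurableSet, Measure.volume_eq_prod,
      Measure.prod_apply (hmeas.preimage hpres.measurable)]
    have hslice : ∀ t : ℝ, volume (Prod.mk t ⁻¹'
        ((MeasurableEquiv.piFinSuccAbove (fun _ : Fin (n + 1) => ℝ) 0).symm ⁻¹'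
          {x : Fin (n + 1) → ℝ | (∀ i, 0 ≤ x i) ∧ ∑ i, x i ≤ r})) =
        (Set.Icc 0 r).indicator
          (fun t => ENNReal.ofReal ((r - t) ^ n / n.factorial)) t := by
      intro t
      by_cases ht : t ∈ Set.Icc 0 r
      · rw [Set.indicator_of_mem ht, ← ih (r - t) (by linarith [ht.2])]
        congr 1
        ext y
        simp [Fin.forall_fin_succ, Fin.sum_univ_succ, MeasurableEquiv.piFinSuccAbove,
          Fin.insertNthEquiv, ht.1, le_sub_iff_add_le']
      · rw [Set.indicator_of_notMem ht]
        convert measure_empty (μ := (volume : Measure (Fin n → ℝ)))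
        ext y
        simp only [Set.mem_preimage, Set.mem_ofPred_eq, Set.mem_empty_iff_false, iff_false]
        rintro ⟨h1, h2⟩
        simp [Fin.forall_fin_succ, Fin.sum_univ_succ, MeasurableEquiv.piFinSuccAbove,
          Fin.insertNthEquiv] at h1 h2
        exact ht ⟨h1.1, by linarith [Finset.sum_nonneg fun i (_ : i ∈ Finset.univ) => h1.2 i]⟩
    simp_rw [hslice]
    rw [lintegral_indicator measurableSet_Icc, ← ofReal_integral_eq_lintegral_ofReal]
    · congr 1
      rw [integral_Icc_eq_integral_Ioc, ← intervalIntegral.integral_of_le hr,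
        intervalIntegral.integral_div,
        intervalIntegral.integral_comp_sub_left (fun x => x ^ n) r, integral_pow,
        Nat.factorial_succ]
      simp
      field_simp
    · exact (Continuous.continuousOn (by fun_prop)).integrableOn_Icc
    · filter_upwards [ae_restrict_mem measurableSet_Icc] with t ht
      have := ht.2
      have : 0 ≤ r - t := by linarith
      positivity

theorem Matrix.abs_det_le_prod_norm_row {ι : Type*} [Fintype ι] [DecidableEq ι]
    (M : Matrix ι ι ℝ) : |M.det| ≤ ∏ i, ‖WithLp.toLp 2 (M i)‖ := by
  let e := Fintype.equivFin ι
  let b : OrthonormalBasis (Fin (Fintype.card ι)) ℝ (EuclideanSpace ℝ ι) :=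
    (EuclideanSpace.basisFun ι ℝ).reindex e
  have : Fact (Module.finrank ℝ (EuclideanSpace ℝ ι) = Fintype.card ι) := ⟨by simp⟩
  have h := b.toBasis.orientation.abs_volumeForm_apply_le
    (fun i => WithLp.toLp 2 (M (e.symm i)))
  rw [Orientation.volumeForm_robust' _ b, e.symm.prod_comp fun i => ‖WithLp.toLp 2 (M i)‖,
    Module.Basis.det_apply] at h
  convert h using 2
  rw [← Matrix.det_submatrix_equiv_self e.symm M, ← Matrix.det_transpose]
  congr 1

theorem prod_le_inv_card_pow_of_sum_eq_one {ι : Type*} [Fintype ι] [Nonempty ι] (a : ι → ℝ)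
    (ha : ∀ i, 0 ≤ a i) (hs : ∑ i, a i = 1) :
    ∏ i, a i ≤ ((Fintype.card ι : ℝ)⁻¹) ^ Fintype.card ι := by
  have hc : (Fintype.card ι : ℝ) ≠ 0 := by simp
  have h := Real.geom_mean_le_arith_mean_weighted Finset.univ
    (fun _ : ι => (Fintype.card ι : ℝ)⁻¹) a (by simp) (by simp) (fun i _ => ha i)
  rw [← Finset.mul_sum, hs, mul_one] at h
  have h' := pow_le_pow_left₀
    (Finset.prod_nonneg fun i _ => Real.rpow_nonneg (ha i) _) h (Fintype.card ι)
  rw [← Finset.prod_pow] at h'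
  simpa [← Real.rpow_mul_natCast (ha _), hc] using h'

/-- Homogeneous matrix of the barycentric coordinates of `x ↦ a + U x` with respect to the corner
simplex, with the constant column rescaled by `s`. -/
def barycentricMatrix {d : ℕ} (s : ℝ) (a : Fin d → ℝ) (U : Matrix (Fin d) (Fin d) ℝ) :
    Matrix (Unit ⊕ Fin d) (Unit ⊕ Fin d) ℝ :=
  Matrix.fromBlocks (Matrix.of fun _ _ => s * (1 - ∑ j, a j))
    (Matrix.of fun _ k => -∑ j, U j k) (Matrix.of fun j _ => s * a j) U

theorem det_barycentricMatrix {d : ℕ} (s : ℝ) (a : Fin d → ℝ) (U : Matrix (Fin d) (Fin d) ℝ) :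
    (barycentricMatrix s a U).det = s * U.det := by
  have : barycentricMatrix s a U =
      Matrix.fromBlocks 1 (Matrix.of fun _ _ => -1) 0 1 *
        Matrix.fromBlocks (Matrix.of fun _ _ => s) 0 (Matrix.of fun j _ => s * a j) U := by
    rw [Matrix.fromBlocks_multiply, barycentricMatrix]
    congr 1
    · ext; simp [Matrix.mul_apply, ← Finset.mul_sum]; ring
    · ext; simp [Matrix.mul_apply]
    · simp
    · simp
  rw [this, Matrix.det_mul, Matrix.det_fromBlocks_zero₂₁, Matrix.det_fromBlocks_zero₁₂]
  simp

theorem norm_toLp_sum_le {n : ℕ} (s c : ℝ) (v : Fin n → ℝ) (w : Unit ⊕ Fin n → ℝ)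
    (hl : w (Sum.inl ()) = s * c) (hr : ∀ k, w (Sum.inr k) = v k)
    (h : ‖WithLp.toLp 2 v‖ ≤ c) : ‖WithLp.toLp 2 w‖ ≤ √(s ^ 2 + 1) * c := by
  have hc : 0 ≤ c := (norm_nonneg _).trans h
  have h2 := pow_le_pow_left₀ (norm_nonneg _) h 2
  refine le_of_sq_le_sq ?_ (by positivity)
  rw [EuclideanSpace.norm_sq_eq] at h2 ⊢
  rw [mul_pow, Real.sq_sqrt (by positivity)]
  simp only [Fintype.sum_sum_type, Finset.univ_unique, Finset.sum_singleton, hr,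
    Real.norm_eq_abs, sq_abs, PUnit.default_eq_unit, hl] at h2 ⊢
  linarith [h2]

theorem abs_det_mul_le_one {d : ℕ} (hd : 0 < d) (a : Fin d → ℝ) (U : Matrix (Fin d) (Fin d) ℝ)
    (hrow : ∀ j, ‖WithLp.toLp 2 (U j)‖ ≤ a j)
    (hsum : ‖WithLp.toLp 2 (fun k => -∑ j, U j k)‖ ≤ 1 - ∑ j, a j) :
    |U.det| * (√d ^ d * √(d + 1) ^ (d + 1)) ≤ 1 := by
  have hα : 0 < √(d : ℝ) := by positivity
  have hβ : 0 < √(d + 1 : ℝ) := by positivity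
  have hα2 : √(d : ℝ) ^ 2 = d := Real.sq_sqrt (by positivity)
  have hβ2 : √(d + 1 : ℝ) ^ 2 = d + 1 := Real.sq_sqrt (by positivity)
  set α := √(d : ℝ)
  set β := √(d + 1 : ℝ)
  let c : Unit ⊕ Fin d → ℝ := Sum.elim (fun _ => 1 - ∑ j, a j) a
  have hc : ∀ i, 0 ≤ c i := by
    rintro (_ | j)
    · exact (norm_nonneg _).trans hsum
    · exact (norm_nonneg _).trans (hrow j)
  have hsq : √((α⁻¹) ^ 2 + 1) = β / α := by
    rw [Real.sqrt_eq_iff_eq_sq (by positivity) (by positivity), div_pow, hβ2]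
    field_simp
    rw [hα2]; ring
  have hrows : ∀ i, ‖WithLp.toLp 2 (barycentricMatrix α⁻¹ a U i)‖ ≤ β / α * c i := by
    rw [← hsq]
    rintro (_ | j)
    · exact norm_toLp_sum_le _ _ _ _ (by rfl) (fun _ => rfl) hsum
    · exact norm_toLp_sum_le _ _ _ _ (by rfl) (fun _ => rfl) (hrow j)
  have h := (Matrix.abs_det_le_prod_norm_row (barycentricMatrix α⁻¹ a U)).trans
    (Finset.prod_le_prod (fun _ _ => norm_nonneg _) fun i _ => hrows i)
  rw [det_barycentricMatrix, Finset.prod_mul_distrib, abs_mul, abs_of_pos (by positivity)] at h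
  have hp := prod_le_inv_card_pow_of_sum_eq_one c hc (by simp [c])
  have hcard : Fintype.card (Unit ⊕ Fin d) = d + 1 := by simp [add_comm]
  rw [hcard] at hp
  simp only [Finset.prod_const, Finset.card_univ, hcard] at h
  push_cast at hp
  rw [← hβ2] at hp
  have h3 := h.trans (mul_le_mul_of_nonneg_left hp (by positivity))
  calc |U.det| * (α ^ d * β ^ (d + 1))
      = α⁻¹ * |U.det| * (α ^ (d + 1) * β ^ (d + 1)) := by field_simp; ring
    _ ≤ (β / α) ^ (d + 1) * ((β ^ 2)⁻¹) ^ (d + 1) * (α ^ (d + 1) * β ^ (d + 1)) := by gcongr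
    _ = 1 := by
      rw [← mul_pow, ← mul_pow, ← mul_pow]
      convert one_pow (M := ℝ) (d + 1)
      field_simp

theorem exists_abs_det_mul_eq_one {d : ℕ} (hd : 0 < d) :
    ∃ (a : Fin d → ℝ) (U : Matrix (Fin d) (Fin d) ℝ),
      (∀ j, ‖WithLp.toLp 2 (U j)‖ ≤ a j) ∧
      ‖WithLp.toLp 2 (fun k => -∑ j, U j k)‖ ≤ 1 - ∑ j, a j ∧
      |U.det| * (√d ^ d * √(d + 1) ^ (d + 1)) = 1 := by
  have hα : 0 < √(d : ℝ) := by positivity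
  have hβ : 0 < √(d + 1 : ℝ) := by positivity
  have hα2 : √(d : ℝ) ^ 2 = d := Real.sq_sqrt (by positivity)
  have hβ2 : √(d + 1 : ℝ) ^ 2 = d + 1 := Real.sq_sqrt (by positivity)
  set α := √(d : ℝ)
  set β := √(d + 1 : ℝ)
  let v : Unit ⊕ Fin d → EuclideanSpace ℝ (Unit ⊕ Fin d) := fun _ => WithLp.toLp 2 fun _ => β⁻¹
  have hv : Orthonormal ℝ (({Sum.inl ()} : Set (Unit ⊕ Fin d)).domRestrict v) := by
    rw [orthonormal_iff_ite]
    rintro ⟨i, rfl⟩ ⟨j, rfl⟩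
    rw [PiLp.inner_apply]
    simp only [Set.domRestrict_apply, v, RCLike.inner_apply, conj_trivial, Finset.sum_const,
      Finset.card_univ, Fintype.card_sum, Fintype.card_unit, Fintype.card_fin, nsmul_eq_mul,
      if_true]
    push_cast
    field_simp
    rw [hβ2]; ring
  obtain ⟨b, hb⟩ := hv.exists_orthonormalBasis_extension_of_card_eq (by simp)
  have hb0 : ∀ i, b (Sum.inl ()) i = β⁻¹ := fun i => by rw [hb _ rfl]
  let Q : Matrix (Unit ⊕ Fin d) (Unit ⊕ Fin d) ℝ := Matrix.of fun i k => b k i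
  have hQQ : Q.transpose * Q = 1 := by
    ext i j
    have := orthonormal_iff_ite.1 b.orthonormal i j
    rw [PiLp.inner_apply] at this
    simpa [Matrix.mul_apply, Q, Matrix.one_apply, mul_comm] using this
  have hQQ' : Q * Q.transpose = 1 := mul_eq_one_comm.1 hQQ
  have hdet : |Q.det| = 1 := by
    have := congrArg Matrix.det hQQ
    rw [Matrix.det_mul, Matrix.det_transpose, Matrix.det_one, ← pow_two] at this
    rwa [← sq_eq_sq₀ (abs_nonneg _) zero_le_one, sq_abs, one_pow]
  have hrow : ∀ i, ∑ k, Q i (Sum.inr k) ^ 2 = α ^ 2 / β ^ 2 := by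
    intro i
    have := congrFun (congrFun hQQ' i) i
    simp [Matrix.mul_apply, ← pow_two, Q, hb0] at this
    have h1 : α ^ 2 / β ^ 2 = 1 - (β ^ 2)⁻¹ := by
      field_simp; rw [hα2, hβ2]; ring
    simp [Q]
    linarith
  have hcol : ∀ k, Q (Sum.inl ()) (Sum.inr k) = -∑ j, Q (Sum.inr j) (Sum.inr k) := by
    intro k
    have := congrFun (congrFun hQQ (Sum.inl ())) (Sum.inr k)
    simp [Matrix.mul_apply, Q, hb0, ← Finset.mul_sum, hβ.ne'] at this
    simp [Q]; linarith
  have hnorm : ∀ i, ‖WithLp.toLp 2 (fun k => (α * β)⁻¹ * Q i (Sum.inr k))‖ = (β ^ 2)⁻¹ := by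
    intro i
    rw [EuclideanSpace.norm_eq, Real.sqrt_eq_iff_eq_sq (by positivity) (by positivity)]
    simp only [Real.norm_eq_abs, sq_abs, mul_pow, ← Finset.mul_sum, hrow]
    field_simp
  have hsumrow : (fun k => -∑ j, (α * β)⁻¹ * Q (Sum.inr j) (Sum.inr k)) =
      fun k => (α * β)⁻¹ * Q (Sum.inl ()) (Sum.inr k) := by
    ext k
    rw [hcol, ← Finset.mul_sum]; ring
  have hone : 1 - ∑ _j : Fin d, (β ^ 2)⁻¹ = (β ^ 2)⁻¹ := by
    simp; field_simp; rw [hβ2]; ring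
  refine ⟨fun _ => (β ^ 2)⁻¹, Matrix.of fun j k => (α * β)⁻¹ * Q (Sum.inr j) (Sum.inr k),
    fun j => (hnorm _).le, ?_, ?_⟩
  · rw [hone]
    simp only [Matrix.of_apply]
    rw [hsumrow, hnorm]
  · have hN : barycentricMatrix α⁻¹ (fun _ => (β ^ 2)⁻¹)
        (Matrix.of fun j k => (α * β)⁻¹ * Q (Sum.inr j) (Sum.inr k)) = (α * β)⁻¹ • Q := by
      ext i k
      rcases i with i | i <;> rcases k with k | k
      · simp only [barycentricMatrix, Matrix.fromBlocks_apply₁₁, hone]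
        simp [Q, hb0]; field_simp
      · simp only [barycentricMatrix, Matrix.fromBlocks_apply₁₂]
        exact congrFun hsumrow k
      · simp [barycentricMatrix, Q, hb0]; field_simp
      · simp [barycentricMatrix]
    have h := congrArg (fun M => |Matrix.det M|) hN
    simp only [det_barycentricMatrix, Matrix.det_smul, abs_mul, hdet] at h
    rw [abs_of_pos (inv_pos.2 hα), abs_of_pos (pow_pos (inv_pos.2 (mul_pos hα hβ)) _)] at h
    simp only [Fintype.card_sum, Fintype.card_unit, Fintype.card_fin] at h
    have h4 : ∀ D : ℝ, α⁻¹ * D = (α * β)⁻¹ ^ (1 + d) * 1 → D * (α ^ d * β ^ (d + 1)) = 1 := by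
      intro D hD
      have : D = α * ((α * β)⁻¹ ^ (1 + d)) := by rw [← mul_one (_ ^ _), ← hD]; field_simp
      rw [this, inv_pow, mul_pow]
      field_simp
      ring
    exact h4 _ h

/-- The simplex with vertices `0` and the standard basis vectors. -/
def cornerSimplex (d : ℕ) : Set (EuclideanSpace ℝ (Fin d)) :=
  {x | (∀ i, 0 ≤ x i) ∧ ∑ i, x i ≤ 1}

theorem volume_cornerSimplex (d : ℕ) : d.factorial * volume (cornerSimplex d) = 1 := by
  have h2 : volume (cornerSimplex d) = volume {x : Fin d → ℝ | (∀ i, 0 ≤ x i) ∧ ∑ i, x i ≤ 1} :=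
    (EuclideanSpace.volume_preserving_symm_measurableEquiv_toLp (Fin d)).measure_preimage_equiv
      {x : Fin d → ℝ | (∀ i, 0 ≤ x i) ∧ ∑ i, x i ≤ 1}
  rw [h2, volume_nonneg_sum_le d 1 zero_le_one, one_pow, one_div,
    ENNReal.ofReal_inv_of_pos (by positivity), ENNReal.ofReal_natCast]
  exact ENNReal.mul_inv_cancel (by positivity) (by simp)

theorem volume_image_affineEquiv {E : Type*} [NormedAddCommGroup E] [NormedSpace ℝ E]
    [FiniteDimensional ℝ E] [MeasurableSpace E] [BorelSpace E] (μ : Measure E) [μ.IsAddHaarMeasure]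
    (f : E ≃ᵃ[ℝ] E) (s : Set E) :
    μ (f '' s) = ENNReal.ofReal |LinearMap.det (f.linear : E →ₗ[ℝ] E)| * μ s := by
  have : f '' s = (f 0 + ·) '' ((f.linear : E →ₗ[ℝ] E) '' s) := by
    rw [Set.image_image]
    refine Set.image_congr fun x _ => ?_
    simpa [add_comm] using f.map_vadd 0 x
  rw [this, Set.image_add_left, measure_preimage_add, Measure.addHaar_image_linearMap]

theorem convexHull_range_cons_zero_basis (d : ℕ) :
    convexHull ℝ (Set.range
      (Fin.cons 0 (EuclideanSpace.basisFun (Fin d) ℝ) :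
        Fin (d + 1) → EuclideanSpace ℝ (Fin d))) = cornerSimplex d := by
  apply Set.Subset.antisymm
  · refine convexHull_min ?_ ?_
    · rintro _ ⟨i, rfl⟩
      refine Fin.cases ?_ (fun j => ?_) i
      · simp [cornerSimplex]
      · simp [cornerSimplex]
        intro i; split_ifs <;> norm_num
    · intro x hx y hy s t hs ht hst
      refine ⟨fun i => ?_, ?_⟩
      · have := hx.1 i
        have := hy.1 i
        simp only [PiLp.add_apply, PiLp.smul_apply, smul_eq_mul]
        positivity
      · simp only [PiLp.add_apply, PiLp.smul_apply, smul_eq_mul, Finset.sum_add_distrib,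
          ← Finset.mul_sum]
        nlinarith [hx.2, hy.2]
  · intro x hx
    refine mem_convexHull_of_exists_fintype (Fin.cons (1 - ∑ i, x i) x)
      (Fin.cons 0 (EuclideanSpace.basisFun (Fin d) ℝ)) ?_ ?_ (fun i => ⟨i, rfl⟩) ?_
    · exact Fin.cases (by simpa using hx.2) hx.1
    · simp [Fin.sum_univ_succ]
    · rw [Fin.sum_univ_succ]
      simpa using (EuclideanSpace.basisFun (Fin d) ℝ).sum_repr x

theorem exists_affineEquiv_image_cornerSimplex {d : ℕ} (p : Fin (d + 1) → EuclideanSpace ℝ (Fin d))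
    (hp : AffineIndependent ℝ p) :
    ∃ g : EuclideanSpace ℝ (Fin d) ≃ᵃ[ℝ] EuclideanSpace ℝ (Fin d),
      g '' cornerSimplex d = convexHull ℝ (Set.range p) := by
  rw [affineIndependent_iff_linearIndependent_vsub ℝ p 0] at hp
  have hli : LinearIndependent ℝ fun i : Fin d => p i.succ - p 0 :=
    hp.comp (fun i : Fin d => ⟨i.succ, Fin.succ_ne_zero i⟩) fun i j h =>
      Fin.succ_injective _ (congrArg Subtype.val h)
  let b := Module.Basis.mk hli (hli.span_eq_top_of_card_eq_finrank' (by simp)).ge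
  let A := (EuclideanSpace.basisFun (Fin d) ℝ).toBasis.equiv b (Equiv.refl _)
  let g := A.toAffineEquiv.trans (AffineEquiv.constVAdd ℝ _ (p 0))
  refine ⟨g, ?_⟩
  have hg : g ∘ (Fin.cons 0 (EuclideanSpace.basisFun (Fin d) ℝ) :
      Fin (d + 1) → EuclideanSpace ℝ (Fin d)) = p := by
    funext i
    refine Fin.cases ?_ (fun j => ?_) i
    · simp [g]
    · have : A (EuclideanSpace.basisFun (Fin d) ℝ j) = p j.succ - p 0 := by
        have h := (EuclideanSpace.basisFun (Fin d) ℝ).toBasis.equiv_apply j b (Equiv.refl _)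
        simpa [A, b] using h
      simp only [Function.comp_apply, Fin.cons_succ, g, AffineEquiv.trans_apply,
        LinearEquiv.coe_toAffineEquiv, AffineEquiv.constVAdd_apply, this, vadd_eq_add]
      abel
  rw [← convexHull_range_cons_zero_basis]
  have := AffineMap.image_convexHull g.toAffineMap (Set.range
    (Fin.cons 0 (EuclideanSpace.basisFun (Fin d) ℝ) : Fin (d + 1) → EuclideanSpace ℝ (Fin d)))
  rw [← Set.range_comp] at this
  rw [← hg]
  exact this

theorem norm_le_of_nonneg_add_inner {E : Type*} [NormedAddCommGroup E] [InnerProductSpace ℝ E]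
    (u : E) (a : ℝ) (h : ∀ x ∈ Metric.closedBall (0 : E) 1, 0 ≤ a + inner ℝ u x) : ‖u‖ ≤ a := by
  by_cases hu : u = 0
  · simpa [hu] using h 0 (by simp)
  · have hn : ‖u‖ ≠ 0 := norm_ne_zero_iff.2 hu
    have := h (-(‖u‖⁻¹ • u)) (by simp [norm_smul, hn])
    rw [inner_neg_right, inner_smul_right, real_inner_self_eq_norm_sq] at this
    field_simp at this
    linarith

theorem nonneg_add_inner_of_norm_le {E : Type*} [NormedAddCommGroup E] [InnerProductSpace ℝ E]
    {u : E} {a : ℝ} (h : ‖u‖ ≤ a) {x : E} (hx : x ∈ Metric.closedBall (0 : E) 1) :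
    0 ≤ a + inner ℝ u x := by
  have h1 := neg_le_of_abs_le (abs_real_inner_le_norm u x)
  have h2 : ‖u‖ * ‖x‖ ≤ ‖u‖ :=
    mul_le_of_le_one_right (norm_nonneg u) (mem_closedBall_zero_iff.1 hx)
  linarith

theorem image_closedBall_subset_cornerSimplex_iff {d : ℕ}
    (f : EuclideanSpace ℝ (Fin d) → EuclideanSpace ℝ (Fin d)) (a : Fin d → ℝ)
    (U : Matrix (Fin d) (Fin d) ℝ)
    (hf : ∀ x j, f x j = a j + inner ℝ (WithLp.toLp 2 (U j)) x) :
    f '' Metric.closedBall 0 1 ⊆ cornerSimplex d ↔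
      (∀ j, ‖WithLp.toLp 2 (U j)‖ ≤ a j) ∧
        ‖WithLp.toLp 2 (fun k => -∑ j, U j k)‖ ≤ 1 - ∑ j, a j := by
  have hsum : ∀ x, 1 - ∑ j, f x j =
      1 - ∑ j, a j + inner ℝ (WithLp.toLp 2 (fun k => -∑ j, U j k)) x := by
    intro x
    have : (WithLp.toLp 2 (fun k => -∑ j, U j k) : EuclideanSpace ℝ (Fin d)) =
        -∑ j, WithLp.toLp 2 (U j) := by
      ext k; simp [WithLp.ofLp_sum]
      exact (Finset.sum_apply k Finset.univ fun j => U j).symm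
    rw [this, inner_neg_left, sum_inner]
    simp only [hf, Finset.sum_add_distrib]
    ring
  rw [Set.image_subset_iff]
  constructor
  · intro h
    refine ⟨fun j => norm_le_of_nonneg_add_inner _ _ fun x hx => ?_,
      norm_le_of_nonneg_add_inner _ _ fun x hx => ?_⟩
    · rw [← hf]; exact (h hx).1 j
    · rw [← hsum]; exact sub_nonneg.2 (h hx).2
  · rintro ⟨h1, h2⟩ x hx
    refine ⟨fun j => ?_, ?_⟩
    · rw [hf]; exact nonneg_add_inner_of_norm_le (h1 j) hx
    · rw [← sub_nonneg, hsum]; exact nonneg_add_inner_of_norm_le h2 hx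

theorem abs_det_linear_mul_le_one {d : ℕ} (hd : 0 < d)
    (h : EuclideanSpace ℝ (Fin d) ≃ᵃ[ℝ] EuclideanSpace ℝ (Fin d))
    (hsub : h '' Metric.closedBall 0 1 ⊆ cornerSimplex d) :
    |LinearMap.det (h.linear : EuclideanSpace ℝ (Fin d) →ₗ[ℝ] EuclideanSpace ℝ (Fin d))| *
      (√d ^ d * √(d + 1) ^ (d + 1)) ≤ 1 := by
  let e := (EuclideanSpace.basisFun (Fin d) ℝ).toBasis
  let L : EuclideanSpace ℝ (Fin d) →ₗ[ℝ] EuclideanSpace ℝ (Fin d) := h.linear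
  have key :=
    (image_closedBall_subset_cornerSimplex_iff h (h 0) (LinearMap.toMatrix e e L) ?_).1 hsub
  · rw [← LinearMap.det_toMatrix e]
    exact abs_det_mul_le_one hd _ _ key.1 key.2
  · intro x j
    have h1 : h x = L x + h 0 := by simpa [L] using h.map_vadd 0 x
    have h2 := congrFun (LinearMap.toMatrix_mulVec_repr e e L x) j
    rw [h1, PiLp.add_apply, add_comm]
    congr 1
    rw [PiLp.inner_apply]
    simpa [e, Matrix.mulVec, dotProduct, mul_comm] using h2.symm

theorem exists_ellipsoid_abs_det_linear_mul_eq_one {d : ℕ} (hd : 0 < d) :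
    ∃ h : EuclideanSpace ℝ (Fin d) ≃ᵃ[ℝ] EuclideanSpace ℝ (Fin d),
      h '' Metric.closedBall 0 1 ⊆ cornerSimplex d ∧
      |LinearMap.det (h.linear : EuclideanSpace ℝ (Fin d) →ₗ[ℝ] EuclideanSpace ℝ (Fin d))| *
        (√d ^ d * √(d + 1) ^ (d + 1)) = 1 := by
  obtain ⟨a, U, h1, h2, h3⟩ := exists_abs_det_mul_eq_one hd
  let e := (EuclideanSpace.basisFun (Fin d) ℝ).toBasis
  let L := Matrix.toLin e e U
  have hL : LinearMap.det L = U.det := LinearMap.det_toLin e U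
  have hdet : LinearMap.det L ≠ 0 := by
    rw [hL]
    rintro h0
    simp [h0] at h3
  let h := (L.equivOfDetNeZero hdet).toAffineEquiv.trans
    (AffineEquiv.constVAdd ℝ _ (WithLp.toLp 2 a))
  have hlin : (h.linear : EuclideanSpace ℝ (Fin d) →ₗ[ℝ] EuclideanSpace ℝ (Fin d)) = L := by
    rfl
  refine ⟨h, (image_closedBall_subset_cornerSimplex_iff h a U ?_).2 ⟨h1, h2⟩, ?_⟩
  · intro x j
    have h4 : h x = WithLp.toLp 2 a + L x := by simp [h]
    rw [h4, PiLp.add_apply]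
    congr 1
    rw [PiLp.inner_apply]
    have h5 := congrFun (LinearMap.toMatrix_mulVec_repr e e L x) j
    simpa [e, L, Matrix.mulVec, dotProduct, mul_comm] using h5.symm
  · rw [hlin, hL, h3]

theorem sqrt_pow_mul_sqrt_pow_eq_rpow (d : ℕ) :
    √(d : ℝ) ^ d * √((d : ℝ) + 1) ^ (d + 1) =
      (d : ℝ) ^ ((d : ℝ) / 2) * ((d : ℝ) + 1) ^ (((d : ℝ) + 1) / 2) := by
  rw [← Real.rpow_natCast √(d : ℝ), ← Real.rpow_natCast √((d : ℝ) + 1), Real.sqrt_eq_rpow,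
    Real.sqrt_eq_rpow, ← Real.rpow_mul (by positivity), ← Real.rpow_mul (by positivity)]
  push_cast
  congr 2 <;> ring

/-- For a `d`-dimensional simplex `Δ` with maximal volume inscribed ellipsoid `E`,
`vol(E)/vol(Δ) = d! · vol(B) / (d^(d/2) · (d+1)^((d+1)/2))`, stated in
cross-multiplied form. -/
theorem simplex_max_ellipsoid_volume_ratio (d : ℕ)
    (p : Fin (d + 1) → EuclideanSpace ℝ (Fin d)) (hp : AffineIndependent ℝ p)
    (E : Set (EuclideanSpace ℝ (Fin d)))
    (hE : IsEllipsoid d E) (hEΔ : E ⊆ convexHull ℝ (Set.range p))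
    (hmax : ∀ E' : Set (EuclideanSpace ℝ (Fin d)),
      IsEllipsoid d E' → E' ⊆ convexHull ℝ (Set.range p) →
        volume E' ≤ volume E) :
    volume E *
        ENNReal.ofReal ((d : ℝ) ^ ((d : ℝ) / 2) *
          ((d : ℝ) + 1) ^ (((d : ℝ) + 1) / 2)) =
      (d.factorial : ℝ≥0∞) *
        volume (Metric.closedBall (0 : EuclideanSpace ℝ (Fin d)) 1) *
        volume (convexHull ℝ (Set.range p)) := by
  obtain ⟨g, hg⟩ := exists_affineEquiv_image_cornerSimplex p hp
  obtain ⟨f, rfl⟩ := hE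
  rcases Nat.eq_zero_or_pos d with rfl | hd
  · have huniv : ∀ s : Set (EuclideanSpace ℝ (Fin 0)), s.Nonempty → s = Set.univ := by
      rintro s ⟨x, hx⟩
      exact Set.eq_univ_of_forall fun y => Subsingleton.elim x y ▸ hx
    have hball : (Metric.closedBall (0 : EuclideanSpace ℝ (Fin 0)) 1).Nonempty := ⟨0, by simp⟩
    rw [huniv _ (hball.image f), huniv _ hball, huniv _ ((hball.image f).mono hEΔ)]
    have hone := volume_cornerSimplex 0
    rw [huniv (cornerSimplex 0) ⟨0, by simp [cornerSimplex]⟩] at hone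
    simp_all
  set B := Metric.closedBall (0 : EuclideanSpace ℝ (Fin d)) 1
  rw [← sqrt_pow_mul_sqrt_pow_eq_rpow, ← hg, volume_image_affineEquiv _ g]
  set K := √(d : ℝ) ^ d * √((d : ℝ) + 1) ^ (d + 1)
  set D := ENNReal.ofReal |LinearMap.det
    (g.linear : EuclideanSpace ℝ (Fin d) →ₗ[ℝ] EuclideanSpace ℝ (Fin d))|
  have hvol : ∀ h : EuclideanSpace ℝ (Fin d) ≃ᵃ[ℝ] EuclideanSpace ℝ (Fin d),
      volume (g '' (h '' B)) * ENNReal.ofReal K = D * volume B * ENNReal.ofReal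
        (|LinearMap.det (h.linear : EuclideanSpace ℝ (Fin d) →ₗ[ℝ] EuclideanSpace ℝ (Fin d))| *
          K) := by
    intro h
    rw [volume_image_affineEquiv, volume_image_affineEquiv, ENNReal.ofReal_mul (abs_nonneg _)]
    ring
  have hfac : d.factorial * volume B * (D * volume (cornerSimplex d)) = D * volume B := by
    calc _ = D * volume B * (d.factorial * volume (cornerSimplex d)) := by ring
      _ = _ := by rw [volume_cornerSimplex, mul_one]
  rw [hfac]
  apply le_antisymm
  · have hfg : f '' B = g '' ((f.trans g.symm) '' B) := by
      simp [Set.image_image]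
    have hsub : (f.trans g.symm) '' B ⊆ cornerSimplex d := by
      rw [← Set.image_subset_image_iff g.injective, ← hfg, hg]
      exact hEΔ
    rw [hfg, hvol]
    refine mul_le_of_le_one_right' ?_
    rw [ENNReal.ofReal_le_one]
    exact abs_det_linear_mul_le_one hd _ hsub
  · obtain ⟨h, hsub, hdet⟩ := exists_ellipsoid_abs_det_linear_mul_eq_one hd
    have hle := hmax (g '' (h '' B)) ⟨h.trans g, by simp [Set.image_image, B]⟩
      (by rw [← hg]; exact Set.image_mono hsub)
    calc D * volume B = volume (g '' (h '' B)) * ENNReal.ofReal K := by rw [hvol, hdet]; simp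
      _ ≤ _ := by gcongr
end

section
/- Assume unit vectors w_1, …, w_m ∈ bd(B) in R^d and positive weights c_1, …, c_m form a John's decomposition of the identity (i.e. Σ c_i w_i = 0 and Σ c_i (w_i ⊗ w_i) = I). Then there exists a subset X ⊆ {w_1, …, w_m} with at most 2d elements such that the polar set X^* = { y ∈ R^d : ⟨x, y⟩ ≤ 1 for all x ∈ X } satisfies vol(X^*) ≤ d^d · (d+1)^{(3d+1)/2} · (d!)^{-1/2} · vol(B). -/
open MeasureTheory
open scoped RealInnerProductSpace

/-- If `c` weighs the rows of `W` into a decomposition of the identity with total weight `d`, then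
some `d` rows have squared determinant at least `d! / d ^ d`. -/
theorem exists_det_sq_ge {d m : ℕ} (W : Fin m → Fin d → ℝ) (c : Fin m → ℝ) (hc : ∀ i, 0 ≤ c i)
    (hI : ∀ j k, ∑ i, c i * W i j * W i k = (1 : Matrix (Fin d) (Fin d) ℝ) j k)
    (hsum : ∑ i, c i = d) :
    ∃ f : Fin d → Fin m, (d.factorial : ℝ) ≤ d ^ d * (Matrix.of fun k => W (f k)).det ^ 2 := by
  have hexp : (1 : ℝ) = ∑ f : Fin d → Fin m,
      (∏ k, c (f k)) * (∏ k, W (f k) k) * (Matrix.of fun k => W (f k)).det := by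
    have h1 : (1 : Matrix (Fin d) (Fin d) ℝ) =
        Matrix.of fun k => ∑ i, (c i * W i k) • W i := by
      ext j k
      simp [← hI, Finset.sum_apply]
    rw [← Matrix.det_one (n := Fin d) (R := ℝ), h1]
    have h2 := (Matrix.detRowAlternating (n := Fin d) (R := ℝ)).toMultilinearMap.map_sum
      (fun k (i : Fin m) => (c i * W i k) • W i)
    refine h2.trans (Finset.sum_congr rfl fun f _ => ?_)
    refine ((Matrix.detRowAlternating (n := Fin d) (R := ℝ)).toMultilinearMap.map_smul_univ
      (fun k => c (f k) * W (f k) k) (fun k => W (f k))).trans ?_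
    rw [Finset.prod_mul_distrib]
    rfl
  have hfac : (d.factorial : ℝ) = ∑ f : Fin d → Fin m,
      (∏ k, c (f k)) * (Matrix.of fun k => W (f k)).det ^ 2 := by
    have hσ : ∀ σ : Equiv.Perm (Fin d), (1 : ℝ) = ∑ f : Fin d → Fin m,
        (∏ k, c (f k)) * (((Equiv.Perm.sign σ : ℤ) : ℝ) * ∏ k, W (f (σ k)) k) *
          (Matrix.of fun k => W (f k)).det := by
      intro σ
      rw [hexp, ← Equiv.sum_comp (σ.arrowCongr (Equiv.refl (Fin m))).symm]
      refine Finset.sum_congr rfl fun f _ => ?_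
      have hd := Matrix.det_permute σ (Matrix.of fun k => W (f k))
      have hp := Equiv.prod_comp σ fun k => c (f k)
      simp only [Equiv.arrowCongr_symm, Equiv.arrowCongr_apply, Function.comp_apply,
        Equiv.symm_symm, Equiv.refl_symm, Equiv.refl_apply] at *
      rw [hp]
      have : (Matrix.of fun k => W (f (σ k))) =
        (Matrix.of fun k => W (f k)).submatrix σ id := rfl
      rw [this, hd]
      ring
    have : (d.factorial : ℝ) = ∑ σ : Equiv.Perm (Fin d), (1 : ℝ) := by
      simp [Fintype.card_perm]
    rw [this, Finset.sum_congr rfl fun σ _ => hσ σ, Finset.sum_comm]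
    refine Finset.sum_congr rfl fun f _ => ?_
    rw [sq, ← mul_assoc, ← Finset.sum_mul, ← Finset.mul_sum]
    congr 2
    rw [Matrix.det_apply']
    rfl
  have hpow : (d : ℝ) ^ d = ∑ f : Fin d → Fin m, ∏ k, c (f k) := by
    rw [← hsum, ← Fintype.piFinset_univ, ← Finset.prod_univ_sum]
    simp
  by_contra! h
  have hd0 : (0 : ℝ) < d ^ d := by exact_mod_cast Nat.pow_self_pos
  have : (d : ℝ) ^ d * d.factorial < d ^ d * d.factorial := by
    conv_lhs => rw [hfac, Finset.mul_sum]
    conv_rhs => rw [hpow, Finset.sum_mul]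
    have hprod : ∀ f : Fin d → Fin m, 0 ≤ ∏ k, c (f k) := fun f =>
      Finset.prod_nonneg fun k _ => hc (f k)
    have hle : ∀ f : Fin d → Fin m, (d : ℝ) ^ d * ((∏ k, c (f k)) *
        (Matrix.of fun k => W (f k)).det ^ 2) ≤ (∏ k, c (f k)) * d.factorial := fun f => by
      have := mul_le_mul_of_nonneg_left (h f).le (hprod f)
      linarith
    obtain ⟨f, -, hf⟩ := Finset.exists_ne_zero_of_sum_ne_zero (hpow ▸ hd0.ne')
    refine Finset.sum_lt_sum (fun f _ => hle f) ⟨f, Finset.mem_univ _, ?_⟩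
    have := mul_lt_mul_of_pos_left (h f) ((hprod f).lt_of_ne' hf)
    linarith
  exact this.false

/-- Conic Carathéodory: a nonnegative combination can be rewritten with at most `finrank` nonzero
coefficients without increasing the sum of the coefficients. -/
theorem exists_conic_sum_card_support_le {ι E : Type*} [Fintype ι] [AddCommGroup E] [Module ℝ E]
    [FiniteDimensional ℝ E] (w : ι → E) (a : ι → ℝ) (ha : ∀ i, 0 ≤ a i) :
    ∃ b : ι → ℝ, (∀ i, 0 ≤ b i) ∧ ∑ i, b i • w i = ∑ i, a i • w i ∧ ∑ i, b i ≤ ∑ i, a i ∧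
      (Finset.univ.filter fun i => b i ≠ 0).card ≤ Module.finrank ℝ E := by
  classical
  induction hn : (Finset.univ.filter fun i => a i ≠ 0).card using Nat.strong_induction_on
    generalizing a with
  | _ n ih =>
  set S := Finset.univ.filter fun i => a i ≠ 0 with hS
  by_cases hcard : S.card ≤ Module.finrank ℝ E
  · exact ⟨a, ha, rfl, le_rfl, hcard⟩
  have hdep : ¬ LinearIndepOn ℝ w (S : Set ι) := fun h => by
    have := LinearIndependent.fintype_card_le_finrank h
    simp at this
    exact hcard this
  obtain ⟨g, hgS, hg0, hgsum, j, hj⟩ : ∃ g : ι → ℝ, (∀ i, i ∉ S → g i = 0) ∧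
      ∑ i, g i • w i = 0 ∧ 0 ≤ ∑ i, g i ∧ ∃ j, 0 < g j := by
    rw [linearIndepOn_finset_iff] at hdep
    push Not at hdep
    obtain ⟨g, hg0, j, hjS, hj⟩ := hdep
    let h : ι → ℝ := fun i => if i ∈ S then g i else 0
    have hh0 : ∑ i, h i • w i = 0 := by simpa [h, ite_smul, Finset.sum_ite_mem] using hg0
    have hhj : h j ≠ 0 := by simpa [h, hjS] using hj
    have hpos : ∀ h : ι → ℝ, h j ≠ 0 → 0 ≤ ∑ i, h i → ∃ j, 0 < h j := by
      intro h hhj hs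
      by_contra! hneg
      have := (Finset.sum_eq_zero_iff_of_nonpos fun i _ => hneg i).1
        (le_antisymm (Finset.sum_nonpos fun i _ => hneg i) hs)
      exact hhj (this j (Finset.mem_univ j))
    rcases le_total 0 (∑ i, h i) with hs | hs
    · exact ⟨h, fun i hi => by simp [h, hi], hh0, hs, hpos h hhj hs⟩
    · have hs' : 0 ≤ ∑ i, (-h) i := by simpa using hs
      exact ⟨-h, fun i hi => by simp [h, hi], by simpa using hh0, hs',
        hpos (-h) (by simpa using hhj) hs'⟩
  obtain ⟨k, hk, hmin⟩ := Finset.exists_min_image (Finset.univ.filter fun i => 0 < g i)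
    (fun i => a i / g i) ⟨j, by simpa using hj⟩
  simp only [Finset.mem_filter, Finset.mem_univ, true_and] at hk hmin
  set t := a k / g k with ht
  have ht0 : 0 ≤ t := div_nonneg (ha k) hk.le
  have hb : ∀ i, 0 ≤ a i - t * g i := fun i => by
    rcases lt_or_ge 0 (g i) with hi | hi
    · have := (le_div_iff₀ hi).1 (hmin i hi)
      linarith
    · nlinarith [ha i, mul_nonneg ht0 (neg_nonneg.2 hi)]
  obtain ⟨b, hb0, hbw, hbs, hbc⟩ := ih _ (by
    rw [← hn]
    refine Finset.card_lt_card ((Finset.ssubset_iff_of_subset fun i hi => ?_).2 ⟨k, ?_, ?_⟩)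
    · by_contra hiS
      have h1 := hgS i hiS
      simp only [hS, Finset.mem_filter, Finset.mem_univ, true_and, not_not] at hiS hi
      simp [h1, hiS] at hi
    · by_contra hkS
      exact hk.ne' (hgS k hkS)
    · simp [ht, div_mul_cancel₀ _ hk.ne']) (fun i => a i - t * g i) hb rfl
  refine ⟨b, hb0, hbw.trans ?_, hbs.trans ?_, hbc⟩
  · simp [sub_smul, mul_smul, ← Finset.smul_sum, hg0]
  · rw [Finset.sum_sub_distrib, ← Finset.mul_sum]
    nlinarith [mul_nonneg ht0 hgsum]

/-- A Chernoff-type bound for the volume of a simplex. -/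
theorem volume_le_one_neg_sum_le (d : ℕ) :
    volume {t : Fin d → ℝ | (∀ k, t k ≤ 1) ∧ -∑ k, t k ≤ (d : ℝ) ^ 2} ≤
      ENNReal.ofReal ((Real.exp 1 * (d + 1)) ^ d) := by
  set l : ℝ := 1 / (d + 1) with hl
  have hd : (0 : ℝ) < d + 1 := by positivity
  have hl0 : 0 < l := by positivity
  let g : ℝ → ℝ := (Set.Iic 1).indicator fun x => Real.exp 1 * (Real.exp (l * x) * Real.exp (-l))
  have hg0 : ∀ x, 0 ≤ g x := fun x => Set.indicator_nonneg (fun _ _ => by positivity) x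
  have hgint : Integrable g volume :=
    (integrable_indicator_iff measurableSet_Iic).2
      (((integrableOn_exp_mul_Iic hl0 1).mul_const _).const_mul _)
  have hgval : ∫ x, g x = Real.exp 1 * (d + 1) := by
    rw [integral_indicator measurableSet_Iic, integral_const_mul, integral_mul_const,
      integral_exp_mul_Iic hl0, mul_one, div_mul_eq_mul_div, ← Real.exp_add, add_neg_cancel,
      Real.exp_zero, hl, one_div_one_div]
  have hprod : Integrable (fun t : Fin d → ℝ => ∏ k, g (t k)) volume :=
    Integrable.fintype_prod fun _ => hgint
  have hval : ∫ t : Fin d → ℝ, ∏ k, g (t k) = (Real.exp 1 * (d + 1)) ^ d := by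
    rw [integral_fintype_prod_volume_eq_pow g, hgval, Fintype.card_fin]
  rw [← hval, ofReal_integral_eq_lintegral_ofReal hprod
    (.of_forall fun t => Finset.prod_nonneg fun k _ => hg0 _)]
  refine meas_le_lintegral₀ hprod.aestronglyMeasurable.aemeasurable.ennreal_ofReal ?_
  rintro t ⟨ht1, ht2⟩
  rw [ENNReal.one_le_ofReal]
  have : ∀ k, g (t k) = Real.exp (1 + (l * t k + -l)) := fun k => by
    simp only [g, Set.indicator_of_mem (show t k ∈ Set.Iic 1 from ht1 k), Real.exp_add]
  simp_rw [this, ← Real.exp_sum]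
  refine Real.one_le_exp ?_
  rw [Finset.sum_add_distrib, Finset.sum_add_distrib, ← Finset.mul_sum]
  simp only [Finset.sum_const, Finset.card_univ, Fintype.card_fin, nsmul_eq_mul, mul_one]
  have h1 : l * (d + 1) = 1 := by rw [hl]; field_simp
  have h2 : l * -∑ k, t k ≤ l * (d : ℝ) ^ 2 := mul_le_mul_of_nonneg_left ht2 hl0.le
  linear_combination h2 + (d : ℝ) * h1

theorem volume_closedBall_ge (d : ℕ) :
    ENNReal.ofReal ((2 / √d) ^ d) ≤
      volume (Metric.closedBall (0 : EuclideanSpace ℝ (Fin d)) 1) := by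
  have hcube : volume (Set.Icc (fun _ : Fin d => -(1 / √d)) fun _ => 1 / √d) =
      ENNReal.ofReal ((2 / √d) ^ d) := by
    rw [Real.volume_Icc_pi, Finset.prod_const, Finset.card_univ, Fintype.card_fin,
      ← ENNReal.ofReal_pow (by rw [sub_neg_eq_add]; positivity)]
    congr 2
    ring
  rw [← hcube, ← (PiLp.volume_preserving_ofLp (Fin d)).measure_preimage
    measurableSet_Icc.nullMeasurableSet]
  refine measure_mono fun x hx => ?_
  rw [mem_closedBall_zero_iff, ← sq_le_one_iff₀ (norm_nonneg x), EuclideanSpace.real_norm_sq_eq]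
  have hx' : ∀ i, x i ^ 2 ≤ 1 / (d : ℝ) := fun i => by
    have := sq_le_sq' (hx.1 i) (hx.2 i)
    rwa [div_pow, one_pow, Real.sq_sqrt (Nat.cast_nonneg d)] at this
  calc ∑ i, x i ^ 2 ≤ ∑ _i : Fin d, 1 / (d : ℝ) := Finset.sum_le_sum fun i _ => hx' i
    _ = d * (1 / (d : ℝ)) := by simp
    _ ≤ 1 := by rw [mul_one_div]; exact div_self_le_one _

theorem exp_one_pow_le (d : ℕ) :
    Real.exp 1 ^ d ≤ 2 ^ d * √((d : ℝ) + 1) ^ (d + 1) := by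
  rcases Nat.eq_zero_or_pos d with rfl | hd
  · simp
  have hd1 : (1 : ℝ) ≤ d := by exact_mod_cast hd
  have he : Real.exp 1 ≤ 2 * √((d : ℝ) + 1) := by
    have : Real.exp 1 / 2 ≤ √((d : ℝ) + 1) :=
      Real.le_sqrt_of_sq_le (by nlinarith [Real.exp_one_lt_d9, Real.exp_pos 1])
    linarith
  have h1 : 1 ≤ √((d : ℝ) + 1) := Real.one_le_sqrt.2 (by linarith)
  calc Real.exp 1 ^ d ≤ (2 * √((d : ℝ) + 1)) ^ d := pow_le_pow_left₀ (Real.exp_pos 1).le he d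
    _ = 2 ^ d * √((d : ℝ) + 1) ^ d := mul_pow ..
    _ ≤ 2 ^ d * √((d : ℝ) + 1) ^ (d + 1) := by
      gcongr
      exact d.le_succ

/-- The numerical comparison between the simplex bound and the target constant, the unit ball being
replaced by its inscribed cube. -/
theorem inv_mul_le_of_factorial_le {d : ℕ} {D : ℝ} (hD : 0 < D)
    (hfac : (d.factorial : ℝ) ≤ d ^ d * D ^ 2) :
    D⁻¹ * (Real.exp 1 * (d + 1)) ^ d ≤
      ((d : ℝ) ^ d * ((d : ℝ) + 1) ^ ((3 * (d : ℝ) + 1) / 2) *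
        ((d.factorial : ℝ)) ^ (-(1 / 2 : ℝ))) * (2 / √d) ^ d := by
  have hd : (0 : ℝ) < d + 1 := by positivity
  have hs : (d : ℝ) ^ d = √d ^ d * √d ^ d := by
    rw [← mul_pow, Real.mul_self_sqrt (Nat.cast_nonneg d)]
  have hs0 : 0 < √(d : ℝ) ^ d := by
    have : (0 : ℝ) < d ^ d := by exact_mod_cast Nat.pow_self_pos
    refine (by positivity : 0 ≤ √(d : ℝ) ^ d).lt_of_ne' fun h => ?_
    simp [hs, h] at this
  have hpow : ((d : ℝ) + 1) ^ ((3 * (d : ℝ) + 1) / 2) =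
      (d + 1) ^ d * √((d : ℝ) + 1) ^ (d + 1) := by
    rw [Real.sqrt_eq_rpow, ← Real.rpow_natCast, ← Real.rpow_natCast, ← Real.rpow_mul hd.le,
      ← Real.rpow_add hd]
    congr 1
    push_cast
    ring
  have hf0 : (0 : ℝ) < √(d.factorial : ℝ) := Real.sqrt_pos.2 (by positivity)
  have hfpow : ((d.factorial : ℝ)) ^ (-(1 / 2 : ℝ)) = (√(d.factorial : ℝ))⁻¹ := by
    rw [Real.rpow_neg (by positivity), Real.sqrt_eq_rpow]
  have hDle : D⁻¹ ≤ √d ^ d * (√(d.factorial : ℝ))⁻¹ := by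
    rw [← div_eq_mul_inv, le_div_iff₀ hf0, inv_mul_le_iff₀ hD]
    exact Real.sqrt_le_iff.2 ⟨by positivity, hfac.trans_eq (by rw [hs]; ring)⟩
  rw [hpow, hfpow, div_pow, hs]
  calc D⁻¹ * (Real.exp 1 * (d + 1)) ^ d
      ≤ (√d ^ d * (√(d.factorial : ℝ))⁻¹) *
        ((2 ^ d * √((d : ℝ) + 1) ^ (d + 1)) * (d + 1) ^ d) := by
        rw [mul_pow]
        gcongr
        exact exp_one_pow_le d
    _ = _ := by field_simp

/-- Core of the quantitative volume Helly theorem: if unit vectors `w i` with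
positive weights `c i` form a John's decomposition of the identity, then some
subset `X` of `{w 1, …, w m}` with at most `2d` elements has polar of volume at
most `d^d · (d+1)^((3d+1)/2) · (d!)^(−1/2) · vol(B)`. -/
theorem john_decomposition_small_polar (d m : ℕ)
    (w : Fin m → EuclideanSpace ℝ (Fin d)) (c : Fin m → ℝ)
    (hw : ∀ i, ‖w i‖ = 1) (hc : ∀ i, 0 < c i)
    (hbal : ∑ i, c i • w i = 0)
    (hdecomp : ∀ x : EuclideanSpace ℝ (Fin d),
      ∑ i, c i • (⟪w i, x⟫ • w i) = x) :
    ∃ X : Finset (EuclideanSpace ℝ (Fin d)),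
      (X : Set (EuclideanSpace ℝ (Fin d))) ⊆ Set.range w ∧
      X.card ≤ 2 * d ∧
      volume {y : EuclideanSpace ℝ (Fin d) | ∀ x ∈ X, ⟪x, y⟫ ≤ 1} ≤
        ENNReal.ofReal ((d : ℝ) ^ d * ((d : ℝ) + 1) ^ ((3 * (d : ℝ) + 1) / 2) *
            ((d.factorial : ℝ)) ^ (-(1 / 2 : ℝ))) *
          volume (Metric.closedBall (0 : EuclideanSpace ℝ (Fin d)) 1) := by
  classical
  have hI : ∀ j k, ∑ i, c i * w i j * w i k = (1 : Matrix (Fin d) (Fin d) ℝ) j k := fun j k => by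
    have := congrArg (fun v : EuclideanSpace ℝ (Fin d) => v j)
      (hdecomp (EuclideanSpace.single k 1))
    simp only [WithLp.ofLp_sum, Finset.sum_apply, PiLp.smul_apply, smul_eq_mul,
      EuclideanSpace.inner_single_right, PiLp.single_apply] at this
    rw [Matrix.one_apply, ← this]
    refine Finset.sum_congr rfl fun i _ => ?_
    simp
    ring
  have hsum : ∑ i, c i = d := by
    calc ∑ i, c i = ∑ i, ∑ j, c i * w i j * w i j := Finset.sum_congr rfl fun i _ => by
          have := EuclideanSpace.real_norm_sq_eq (w i)
          rw [hw i, one_pow] at this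
          simp_rw [mul_assoc, ← sq, ← Finset.mul_sum, ← this, mul_one]
      _ = d := by
          rw [Finset.sum_comm]
          simp [hI]
  obtain ⟨f, hf⟩ := exists_det_sq_ge (fun i => (w i).ofLp) c (fun i => (hc i).le) hI hsum
  set M : Matrix (Fin d) (Fin d) ℝ := Matrix.of fun k => (w (f k)).ofLp
  have hdet : M.det ≠ 0 := fun h => by
    have : (0 : ℝ) < d.factorial := by positivity
    rw [h] at hf
    linarith
  set p : EuclideanSpace ℝ (Fin d) := -∑ k, w (f k) with hp
  have hpn : ‖p‖ ≤ d := by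
    rw [hp, norm_neg]
    refine (norm_sum_le _ _).trans ?_
    simp [hw]
  obtain ⟨b, hb0, hbw, hbs, hbc⟩ := exists_conic_sum_card_support_le w
    (fun i => c i * (⟪w i, p⟫ + ‖p‖)) fun i => by
      have := neg_le_of_abs_le (abs_real_inner_le_norm (w i) p)
      rw [hw i, one_mul] at this
      exact mul_nonneg (hc i).le (by linarith)
  rw [finrank_euclideanSpace_fin] at hbc
  have hbp : ∑ i, b i • w i = p := by
    rw [hbw]
    simp_rw [mul_add, add_smul, Finset.sum_add_distrib, mul_smul, hdecomp p]
    simp_rw [smul_comm (c _) ‖p‖, ← Finset.smul_sum, hbal, smul_zero, add_zero]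
  have hbd : ∑ i, b i ≤ (d : ℝ) ^ 2 := by
    refine hbs.trans ?_
    have h0 : ∑ i, c i * ⟪w i, p⟫ = 0 := by
      simp_rw [← real_inner_smul_left, ← sum_inner, hbal, inner_zero_left]
    simp_rw [mul_add, Finset.sum_add_distrib, h0, ← Finset.sum_mul, hsum]
    nlinarith [Nat.cast_nonneg (α := ℝ) d]
  refine ⟨(Finset.univ.image fun k => w (f k)) ∪
    (Finset.univ.filter fun i => b i ≠ 0).image w, ?_, ?_, ?_⟩
  · intro x hx
    simp only [Finset.coe_union, Finset.coe_image, Set.mem_union, Set.mem_image] at hx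
    rcases hx with ⟨k, -, rfl⟩ | ⟨i, -, rfl⟩ <;> exact ⟨_, rfl⟩
  · refine (Finset.card_union_le _ _).trans ?_
    have h1 := Finset.card_image_le (s := Finset.univ) (f := fun k => w (f k))
    have h2 := Finset.card_image_le (s := Finset.univ.filter fun i => b i ≠ 0) (f := w)
    rw [Finset.card_univ, Fintype.card_fin] at h1
    omega
  · set T := {t : Fin d → ℝ | (∀ k, t k ≤ 1) ∧ -∑ k, t k ≤ (d : ℝ) ^ 2}
    have hMy : ∀ (y : EuclideanSpace ℝ (Fin d)) k, Matrix.toLin' M y.ofLp k = ⟪w (f k), y⟫ := by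
      intro y k
      rw [EuclideanSpace.inner_eq_star_dotProduct, Matrix.toLin'_apply, dotProduct_comm]
      rfl
    have hsub : {y : EuclideanSpace ℝ (Fin d) | ∀ x ∈ (Finset.univ.image fun k => w (f k)) ∪
        (Finset.univ.filter fun i => b i ≠ 0).image w, ⟪x, y⟫ ≤ 1} ⊆
        WithLp.ofLp ⁻¹' (Matrix.toLin' M ⁻¹' T) := by
      intro y hy
      simp only [Set.mem_ofPred_eq, Finset.mem_union, Finset.mem_image, Finset.mem_univ, true_and,
        Finset.mem_filter] at hy
      refine ⟨fun k => ?_, ?_⟩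
      · rw [hMy]
        exact hy _ (.inl ⟨k, rfl⟩)
      · simp_rw [hMy]
        rw [← sum_inner, ← inner_neg_left, ← hp, ← hbp, sum_inner]
        refine (Finset.sum_le_sum fun i _ => ?_).trans hbd
        rw [real_inner_smul_left]
        rcases eq_or_ne (b i) 0 with h | h
        · simp [h]
        · exact mul_le_of_le_one_right (hb0 i) (hy _ (.inr ⟨i, h, rfl⟩))
    have hT : MeasurableSet T := by
      refine IsClosed.measurableSet (.and ?_ ?_)
      · simp only [Set.ofPred_forall]
        exact isClosed_iInter fun k => isClosed_le (continuous_apply k) continuous_const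
      · exact isClosed_le (by fun_prop) continuous_const
    calc _ ≤ volume (WithLp.ofLp ⁻¹' (Matrix.toLin' M ⁻¹' T)) := measure_mono hsub
      _ = ENNReal.ofReal |M.det|⁻¹ * volume T := by
        rw [(PiLp.volume_preserving_ofLp (Fin d)).measure_preimage
          ((Matrix.toLin' M).continuous_of_finiteDimensional.measurable hT).nullMeasurableSet,
          Measure.addHaar_preimage_linearMap volume (by rwa [LinearMap.det_toLin']),
          LinearMap.det_toLin', abs_inv]
      _ ≤ ENNReal.ofReal |M.det|⁻¹ * ENNReal.ofReal ((Real.exp 1 * (d + 1)) ^ d) := by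
        gcongr
        exact volume_le_one_neg_sum_le d
      _ ≤ ENNReal.ofReal (((d : ℝ) ^ d * ((d : ℝ) + 1) ^ ((3 * (d : ℝ) + 1) / 2) *
            ((d.factorial : ℝ)) ^ (-(1 / 2 : ℝ))) * (2 / √d) ^ d) := by
        rw [← ENNReal.ofReal_mul (by positivity)]
        exact ENNReal.ofReal_le_ofReal
          (inv_mul_le_of_factorial_le (abs_pos.2 hdet) (by rwa [sq_abs]))
      _ ≤ _ := by
        rw [ENNReal.ofReal_mul (by positivity)]
        gcongr
        exact volume_closedBall_ge d
end
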